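/- arXiv:1609.07575 — 2 statements merged into one kernel-verified Lean document; each statement's English description precedes it below -/
import Mathlib

section
/- Let k ≤ n be positive integers. The family of monomials gs_π · x_{π_1}^{i_1} x_{π_2}^{i_2} ⋯ x_{π_{n−k}}^{i_{n−k}}, indexed by pairs (π, (i_1, …, i_{n−k})) where π ∈ S_n satisfies des(π) < k and k − des(π) > i_1 ≥ i_2 ≥ … ≥ i_{n−k} ≥ 0, descends under the quotient map ℚ[x_1, …, x_n] → R_{n,k} to a basis of R_{n,k} as a ℚ-vector space; in particular, the images indexed by distinct pairs are distinct and linearly independent. -/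
open MvPolynomial

/-- The ideal `I_{n,k} ⊆ ℚ[x_1, …, x_n]` generated by `x_1^k, …, x_n^k` together with
the elementary symmetric polynomials `e_d(x_1, …, x_n)` for `n−k+1 ≤ d ≤ n`. -/
noncomputable def Ink (n k : ℕ) : Ideal (MvPolynomial (Fin n) ℚ) :=
  Ideal.span ({p | ∃ i : Fin n, p = X i ^ k} ∪
    {p | ∃ d : ℕ, n - k + 1 ≤ d ∧ d ≤ n ∧ p = esymm (Fin n) ℚ d})

/-- The descent set of `π ∈ S_n` (0-based positions): positions `i` (representing the
1-based position `i+1 ≤ n-1`) with `π_i > π_{i+1}`. -/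
def desSet {n : ℕ} (π : Equiv.Perm (Fin n)) : Finset (Fin n) :=
  Finset.univ.filter (fun i => ∃ j : Fin n, (j : ℕ) = (i : ℕ) + 1 ∧ π j < π i)

/-- The generalized Garsia–Stanton monomial `gs_π · x_{π_1}^{v_1} ⋯ x_{π_{n−k}}^{v_{n−k}}`:
the exponent of `x_{π_j}` is `|Des(π) ∩ {j, …, n−1}|` (from the Garsia–Stanton monomial
`gs_π`) plus `v_j` when `j ≤ n−k`. -/
noncomputable def gsMon (n k : ℕ) (π : Equiv.Perm (Fin n)) (v : Fin (n - k) → ℕ) :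
    MvPolynomial (Fin n) ℚ :=
  ∏ j : Fin n, X (π j) ^
    (((desSet π).filter (fun i => j ≤ i)).card +
      if h : (j : ℕ) < n - k then v ⟨(j : ℕ), h⟩ else 0)

/-- Indexing data for the generalized Garsia–Stanton basis of `R_{n,k}`: pairs
`(π, v)` with `des(π) < k` and `k − des(π) > v_1 ≥ v_2 ≥ ⋯ ≥ v_{n−k} ≥ 0`. -/
def GSIndex (n k : ℕ) : Type :=
  {pv : Equiv.Perm (Fin n) × (Fin (n - k) → ℕ) //
    (desSet pv.1).card < k ∧
    (∀ a b : Fin (n - k), a ≤ b → pv.2 b ≤ pv.2 a) ∧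
    ∀ a : Fin (n - k), pv.2 a < k - (desSet pv.1).card}


section Counting

variable {n : ℕ}

theorem Fin.rel_of_le_of_adjacent {R : Fin n → Fin n → Prop} (hrefl : ∀ p, R p p)
    (htrans : ∀ p q r, R p q → R q r → R p r)
    (hadj : ∀ p q : Fin n, (q : ℕ) = p + 1 → R p q) {p q : Fin n} (hpq : p ≤ q) : R p q := by
  obtain ⟨p, hp⟩ := p
  obtain ⟨q, hq⟩ := q
  replace hpq : p ≤ q := hpq
  induction q, hpq using Nat.le_induction with
  | base => exact hrefl _
  | succ q hpq ih => exact htrans _ ⟨q, by omega⟩ _ (ih _) (hadj _ _ rfl)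

/-- The exponent of `x_{π_j}` in the Garsia–Stanton monomial of `π`. -/
def desFrom (π : Equiv.Perm (Fin n)) (j : Fin n) : ℕ :=
  ((desSet π).filter (fun i => j ≤ i)).card

theorem mem_desSet_iff {π : Equiv.Perm (Fin n)} {p q : Fin n} (h : (q : ℕ) = p + 1) :
    p ∈ desSet π ↔ π q < π p := by
  simp only [desSet, Finset.mem_filter, Finset.mem_univ, true_and]
  constructor
  · rintro ⟨j, hj, hlt⟩
    rwa [Fin.ext (hj.trans h.symm)] at hlt
  · exact fun hlt => ⟨q, h, hlt⟩

theorem val_add_one_lt_of_mem_desSet {π : Equiv.Perm (Fin n)} {p : Fin n} (h : p ∈ desSet π) :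
    (p : ℕ) + 1 < n := by
  simp only [desSet, Finset.mem_filter, Finset.mem_univ, true_and] at h
  obtain ⟨j, hj, -⟩ := h
  omega

theorem desFrom_adjacent (π : Equiv.Perm (Fin n)) {p q : Fin n} (h : (q : ℕ) = p + 1) :
    desFrom π p = desFrom π q + if π q < π p then 1 else 0 := by
  have key : (desSet π).filter (fun i => p ≤ i) =
      (desSet π).filter (fun i => q ≤ i) ∪ (if π q < π p then {p} else ∅) := by
    ext i
    have hi : p ≤ i ↔ q ≤ i ∨ i = p := by
      rw [Fin.le_def, Fin.le_def, Fin.ext_iff]; omega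
    split_ifs with hd
    · simp only [Finset.mem_filter, Finset.mem_union, Finset.mem_singleton, hi]
      have := (mem_desSet_iff h).2 hd
      grind
    · have := (mem_desSet_iff h).not.2 hd
      simp only [Finset.mem_filter, Finset.union_empty, hi]
      grind
  rw [desFrom, key, Finset.card_union_of_disjoint, desFrom]
  · split_ifs <;> simp
  · split_ifs
    · simp only [Finset.disjoint_singleton_right, Finset.mem_filter, not_and, Fin.le_def]
      omega
    · simp

theorem desFrom_eq_zero_of_last (π : Equiv.Perm (Fin n)) {p : Fin n} (h : (p : ℕ) + 1 = n) :
    desFrom π p = 0 := by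
  rw [desFrom, Finset.card_eq_zero, Finset.filter_eq_empty_iff]
  intro i hi hpi
  have := val_add_one_lt_of_mem_desSet hi
  rw [Fin.le_def] at hpi
  omega

theorem desFrom_eq_card_of_first (π : Equiv.Perm (Fin n)) {p : Fin n} (h : (p : ℕ) = 0) :
    desFrom π p = (desSet π).card := by
  rw [desFrom, Finset.filter_true_of_mem]
  intro i _
  rw [Fin.le_def]
  omega

theorem desFrom_lt_or_eq_and_le (π : Equiv.Perm (Fin n)) {p q : Fin n} (h : p ≤ q) :
    desFrom π q < desFrom π p ∨ desFrom π q = desFrom π p ∧ π p ≤ π q := by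
  refine Fin.rel_of_le_of_adjacent
    (R := fun p q => desFrom π q < desFrom π p ∨ desFrom π q = desFrom π p ∧ π p ≤ π q)
    (by simp) ?_ ?_ h
  · intro p q r h₁ h₂
    grind
  · intro p q hpq
    have := desFrom_adjacent π hpq
    split_ifs at this with hd
    · omega
    · exact Or.inr ⟨by omega, not_lt.1 hd⟩

/-- `π` lists the indices by weakly decreasing value of `a`, ties by increasing index. -/
def SortsDesc (a : Fin n → ℕ) (π : Equiv.Perm (Fin n)) : Prop :=
  ∀ p q : Fin n, p < q → a (π q) < a (π p) ∨ a (π q) = a (π p) ∧ π p < π q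

theorem exists_sortsDesc (a : Fin n → ℕ) : ∃ π, SortsDesc a π := by
  let key : Fin n → ℕᵒᵈ ×ₗ Fin n := fun i => toLex (OrderDual.toDual (a i), i)
  have hinj : Function.Injective key := fun i j h => by
    simpa [key] using congrArg (fun x => (ofLex x).2) h
  have hmono : StrictMono (key ∘ Tuple.sort key) :=
    (Tuple.monotone_sort key).strictMono_of_injective (hinj.comp (Tuple.sort key).injective)
  refine ⟨Tuple.sort key, fun p q hpq => ?_⟩
  have := hmono hpq
  simp only [Function.comp, key, Prod.Lex.toLex_lt_toLex, OrderDual.toDual_lt_toDual,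
    OrderDual.toDual_inj] at this
  grind

theorem SortsDesc.desFrom_add_le {a : Fin n → ℕ} {π : Equiv.Perm (Fin n)} (h : SortsDesc a π)
    {p q : Fin n} (hpq : p ≤ q) : desFrom π p + a (π q) ≤ desFrom π q + a (π p) := by
  refine Fin.rel_of_le_of_adjacent
    (R := fun p q => desFrom π p + a (π q) ≤ desFrom π q + a (π p))
    (fun _ => le_rfl) (fun p q r h₁ h₂ => by omega) (fun p q hadj => ?_) hpq
  have hlt : p < q := by rw [Fin.lt_def]; omega
  have := desFrom_adjacent π hadj
  have := h p q hlt
  grind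

theorem SortsDesc.desFrom_le {a : Fin n → ℕ} {π : Equiv.Perm (Fin n)} (h : SortsDesc a π)
    (p : Fin n) : desFrom π p ≤ a (π p) := by
  have hn : 0 < n := p.pos
  have := h.desFrom_add_le (p := p) (q := ⟨n - 1, by omega⟩) (by rw [Fin.le_def]; simp; omega)
  have := desFrom_eq_zero_of_last π (p := ⟨n - 1, by omega⟩) (by simp; omega)
  omega

end Counting

section Straightening

variable {n : ℕ}

/-- A statistic on exponent vectors which strictly decreases under straightening. -/
def expWeight (a : Fin n → ℕ) : ℕ := ∑ i, a i * (n * a i + 2 * (n - i))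

theorem expWeight_add_indicator (b : Fin n → ℕ) (S : Finset (Fin n)) :
    expWeight (fun i => b i + if i ∈ S then 1 else 0) =
      expWeight b + ∑ i ∈ S, (2 * (n * b i + (n - i)) + n) := by
  rw [expWeight, expWeight, ← Finset.sum_filter_add_sum_filter_not Finset.univ (· ∈ S),
    ← Finset.sum_filter_add_sum_filter_not Finset.univ (· ∈ S) (fun i => b i * _),
    Finset.sum_congr rfl (g := fun i => b i * (n * b i + 2 * (n - i)) +
      (2 * (n * b i + (n - i)) + n)) fun i hi => ?_,
    Finset.sum_congr (s₁ := Finset.univ.filter (· ∉ S)) rfl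
      (g := fun i => b i * (n * b i + 2 * (n - i))) fun i hi => ?_]
  · simp only [Finset.filter_mem_eq_inter, Finset.univ_inter, Finset.sum_add_distrib]
    ring
  · simp [(Finset.mem_filter.1 hi).2]
  · simp only [(Finset.mem_filter.1 hi).2, if_true]
    ring

theorem Finset.sum_lt_sum_of_card_eq {ι : Type*} [DecidableEq ι] {S T : Finset ι} (f : ι → ℕ)
    (hcard : S.card = T.card) (hne : S ≠ T) (hf : ∀ i ∈ T, ∀ j ∉ T, f j < f i) :
    ∑ i ∈ S, f i < ∑ i ∈ T, f i := by
  have hsd : (S \ T).card = (T \ S).card := Finset.card_sdiff_comm hcard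
  have hS : (S \ T).Nonempty := by
    rw [Finset.nonempty_iff_ne_empty, Ne, Finset.sdiff_eq_empty_iff_subset]
    exact fun h => hne (Finset.eq_of_subset_of_card_le h hcard.ge)
  have hT : (T \ S).Nonempty := by rw [← Finset.card_pos, ← hsd]; exact hS.card_pos
  obtain ⟨i₀, hi₀, hmin⟩ := Finset.exists_min_image (T \ S) f hT
  rw [← Finset.sum_sdiff_lt_sum_sdiff]
  calc ∑ i ∈ S \ T, f i < ∑ _i ∈ S \ T, f i₀ :=
        Finset.sum_lt_sum_of_nonempty hS fun j hj =>
          hf i₀ (Finset.mem_sdiff.1 hi₀).1 j (Finset.mem_sdiff.1 hj).2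
    _ = ∑ _i ∈ T \ S, f i₀ := by simp [hsd]
    _ ≤ ∑ i ∈ T \ S, f i := Finset.sum_le_sum hmin

theorem prod_X_perm_pow (π : Equiv.Perm (Fin n)) (e : Fin n → ℕ) (a : Fin n →₀ ℕ)
    (h : ∀ j, e j = a (π j)) :
    ∏ j, (X (π j) : MvPolynomial (Fin n) ℚ) ^ e j = monomial a 1 := by
  rw [monomial_eq, C_1, one_mul, Finsupp.prod_fintype _ _ (by simp),
    ← Equiv.prod_comp π (fun i => X i ^ a i)]
  simp [h]

theorem X_pow_mem_Ink (n k : ℕ) (i : Fin n) : X i ^ k ∈ Ink n k :=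
  Ideal.subset_span (Or.inl ⟨i, rfl⟩)

theorem esymm_mem_Ink {n k d : ℕ} (h₁ : n - k + 1 ≤ d) (h₂ : d ≤ n) :
    esymm (Fin n) ℚ d ∈ Ink n k :=
  Ideal.subset_span (Or.inr ⟨d, h₁, h₂, rfl⟩)

theorem monomial_mem_Ink_of_le {k : ℕ} {a : Fin n →₀ ℕ} {i : Fin n} (h : k ≤ a i) :
    monomial a 1 ∈ Ink n k := by
  refine Ideal.mem_of_dvd _ ?_ (X_pow_mem_Ink n k i)
  rw [X_pow_eq_monomial, monomial_dvd_monomial]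
  simp [Finsupp.single_le_iff, h]

/-- The generalized Garsia–Stanton monomial attached to an index. -/
noncomputable def gsPoly {n k : ℕ} (x : GSIndex n k) : MvPolynomial (Fin n) ℚ :=
  gsMon n k x.1.1 x.1.2

theorem SortsDesc.exists_gsPoly_eq {k : ℕ} (hk : 1 ≤ k) {a : Fin n →₀ ℕ}
    {π : Equiv.Perm (Fin n)} (h : SortsDesc a π) (ha : ∀ i, a i < k)
    (htail : ∀ p : Fin n, n - k ≤ p → a (π p) ≤ desFrom π p) :
    ∃ x : GSIndex n k, gsPoly x = monomial a 1 := by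
  let v : Fin (n - k) → ℕ := fun j => a (π ⟨j, by omega⟩) - desFrom π ⟨j, by omega⟩
  have hle := h.desFrom_le
  have hv : ∀ i j : Fin (n - k), i ≤ j → v j ≤ v i := fun i j hij => by
    have := h.desFrom_add_le (p := ⟨i, by omega⟩) (q := ⟨j, by omega⟩) hij
    simp only [v]
    omega
  have hdes : ∀ p : Fin n, (desSet π).card + (a (π p) - desFrom π p) < k := fun p => by
    have hn := p.pos
    have := h.desFrom_add_le (p := ⟨0, hn⟩) (q := p) (Nat.zero_le _)
    have := desFrom_eq_card_of_first π (p := ⟨0, hn⟩) rfl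
    have := ha (π ⟨0, hn⟩)
    have := hle p
    omega
  refine ⟨⟨(π, v), ?_, hv, fun j => ?_⟩, ?_⟩
  · rcases n.eq_zero_or_pos with rfl | hn
    · simpa [desSet] using Nat.pos_of_ne_zero (Nat.one_le_iff_ne_zero.1 hk)
    · have := hdes ⟨0, hn⟩
      dsimp only
      omega
  · have := hdes ⟨j, by omega⟩
    simp only [v]
    omega
  · refine prod_X_perm_pow π _ a fun j => ?_
    change desFrom π j + _ = _
    split_ifs with hj
    · exact Nat.add_sub_cancel' (hle j)
    · exact (hle j).antisymm (htail j (not_lt.1 hj))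

theorem sum_monomial_add_mem_Ink {k d : ℕ} (h₁ : n - k + 1 ≤ d) (h₂ : d ≤ n)
    (b : Fin n →₀ ℕ) :
    ∑ S ∈ Finset.powersetCard d Finset.univ,
      monomial (b + ∑ i ∈ S, Finsupp.single i 1) (1 : ℚ) ∈ Ink n k := by
  have := (Ink n k).mul_mem_left (monomial b 1) (esymm_mem_Ink h₁ h₂)
  simpa [esymm_eq_sum_monomial, Finset.mul_sum, monomial_mul] using this

theorem sum_single_one_apply (S : Finset (Fin n)) (i : Fin n) :
    (∑ j ∈ S, Finsupp.single j 1 : Fin n →₀ ℕ) i = if i ∈ S then 1 else 0 := by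
  simp [Finsupp.finsetSum_apply, Finsupp.single_apply]

theorem degree_sum_single_one (S : Finset (Fin n)) :
    (∑ j ∈ S, Finsupp.single j 1 : Fin n →₀ ℕ).degree = S.card := by
  simp [map_sum]

/-- If the tail condition of a Garsia–Stanton monomial fails, a product of the first variables
splits off whose indices are leading for the straightening order. -/
theorem SortsDesc.exists_leading_set {a : Fin n →₀ ℕ} {π : Equiv.Perm (Fin n)}
    (h : SortsDesc a π) {p₀ : Fin n} (hp₀ : desFrom π p₀ < a (π p₀)) :
    ∃ (b : Fin n →₀ ℕ) (T : Finset (Fin n)), (p₀ : ℕ) + 1 ≤ T.card ∧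
      a = b + ∑ i ∈ T, Finsupp.single i 1 ∧
      ∀ i ∈ T, ∀ j ∉ T, b j < b i ∨ b j = b i ∧ i < j := by
  let F := Finset.univ.filter fun p => desFrom π p < a (π p)
  have hF : F.Nonempty := ⟨p₀, by simpa [F] using hp₀⟩
  obtain ⟨m, hmF, hmax⟩ := F.exists_max_image id hF
  have hm : desFrom π m < a (π m) := by simpa [F] using hmF
  have hp₀m : p₀ ≤ m := hmax p₀ (by simpa [F] using hp₀)
  let T := (Finset.Iic m).map π.toEmbedding
  have hT : ∀ p, π p ∈ T ↔ p ≤ m := fun p => by simp [T]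
  have hpos : ∀ p ≤ m, desFrom π p < a (π p) := fun p hp => by
    have := h.desFrom_add_le hp
    omega
  have hle : ∑ i ∈ T, Finsupp.single i 1 ≤ a := fun i => by
    rw [sum_single_one_apply]
    split_ifs with hi
    · obtain ⟨p, rfl⟩ := π.surjective i
      have := hpos p ((hT p).1 hi)
      omega
    · exact Nat.zero_le _
  refine ⟨a - ∑ i ∈ T, Finsupp.single i 1, T, ?_, (tsub_add_cancel_of_le hle).symm, ?_⟩
  · simp only [T, Finset.card_map, Fin.card_Iic]
    rw [Fin.le_def] at hp₀m
    omega
  · intro i hi j hj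
    obtain ⟨p, rfl⟩ := π.surjective i
    obtain ⟨q, rfl⟩ := π.surjective j
    simp only [Finsupp.tsub_apply, sum_single_one_apply, if_pos hi, if_neg hj]
    rw [hT] at hi hj
    have h₁ := hpos p hi
    have h₂ : a (π q) ≤ desFrom π q := by
      by_contra hq
      exact hj (hmax q (by simpa [F] using hq))
    have h₃ := desFrom_lt_or_eq_and_le π (hi.trans (not_le.1 hj).le)
    have h₄ : π p ≠ π q := fun he => hj (π.injective he ▸ hi)
    rcases h₃ with h₃ | ⟨h₃, h₅⟩
    · omega
    · have := lt_of_le_of_ne h₅ h₄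
      omega

/-- Straightening: every monomial is, modulo `I_{n,k}`, a combination of generalized
Garsia–Stanton monomials of the same degree. -/
theorem monomial_mem_span_gsPoly_sup {k : ℕ} (hk : 1 ≤ k) (a : Fin n →₀ ℕ) :
    monomial a 1 ∈ Submodule.span ℚ (gsPoly '' {x : GSIndex n k | (gsPoly x).totalDegree = a.degree})
      ⊔ (Ink n k).restrictScalars ℚ := by
  induction hw : expWeight a using Nat.strong_induction_on generalizing a with
  | _ w ih =>
  by_cases ha : ∀ i, a i < k
  swap
  · push Not at ha
    obtain ⟨i, hi⟩ := ha
    exact Submodule.mem_sup_right (monomial_mem_Ink_of_le hi)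
  obtain ⟨π, hπ⟩ := exists_sortsDesc a
  by_cases htail : ∀ p : Fin n, n - k ≤ p → a (π p) ≤ desFrom π p
  · obtain ⟨x, hx⟩ := hπ.exists_gsPoly_eq hk ha htail
    refine Submodule.mem_sup_left (Submodule.subset_span ⟨x, ?_, hx⟩)
    rw [Set.mem_ofPred_eq, hx, totalDegree_monomial _ one_ne_zero]
    rfl
  push Not at htail
  obtain ⟨p, hp, hlt⟩ := htail
  obtain ⟨b, T, hT, rfl, hlead⟩ := hπ.exists_leading_set hlt
  have hsum := sum_monomial_add_mem_Ink (k := k) (d := T.card) (by omega) (card_finset_fin_le T) b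
  rw [← Finset.add_sum_erase _ _ (Finset.mem_powersetCard.2 ⟨T.subset_univ, rfl⟩)] at hsum
  rw [← add_sub_cancel_right (monomial _ 1) (∑ S ∈ (Finset.powersetCard T.card Finset.univ).erase T,
    monomial (b + ∑ i ∈ S, Finsupp.single i 1) (1 : ℚ))]
  refine Submodule.sub_mem _ (Submodule.mem_sup_right hsum) (Submodule.sum_mem _ fun S hS => ?_)
  obtain ⟨hne, hS⟩ := Finset.mem_erase.1 hS
  have hcard := (Finset.mem_powersetCard.1 hS).2
  have hdeg : (b + ∑ i ∈ S, Finsupp.single i 1).degree =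
      (b + ∑ i ∈ T, Finsupp.single i 1).degree := by
    simp only [map_add, degree_sum_single_one, hcard]
  rw [← hdeg]
  refine ih _ ?_ _ rfl
  rw [← hw]
  simp only [Finsupp.coe_add, Pi.add_def, sum_single_one_apply, expWeight_add_indicator]
  refine Nat.add_lt_add_left (Finset.sum_lt_sum_of_card_eq _ hcard hne fun i hi j hj => ?_) _
  rcases hlead i hi j hj with hlt | ⟨heq, hlt⟩
  · have : n * (b j + 1) ≤ n * b i := Nat.mul_le_mul_left n hlt
    rw [mul_add] at this
    omega
  · rw [Fin.lt_def] at hlt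
    rw [heq]
    omega

end Straightening

section Deformation

variable {σ : Type*}

/-- The polynomials of degree less than `d`. -/
noncomputable def degreeLT (σ : Type*) (d : ℕ) : Submodule ℚ (MvPolynomial σ ℚ) :=
  restrictSupport ℚ {m | m.degree < d}

theorem mem_degreeLT {d : ℕ} {p : MvPolynomial σ ℚ} :
    p ∈ degreeLT σ d ↔ ∀ m ∈ p.support, m.degree < d := by
  rw [degreeLT, mem_restrictSupport_iff]
  rfl

theorem MvPolynomial.IsHomogeneous.degree_eq_of_mem_support {d : ℕ} {p : MvPolynomial σ ℚ}
    (hp : p.IsHomogeneous d) {m : σ →₀ ℕ} (hm : m ∈ p.support) : m.degree = d := by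
  rw [Finsupp.degree_eq_weight_one]
  exact hp (mem_support_iff.1 hm)

theorem MvPolynomial.IsHomogeneous.mem_degreeLT {d e : ℕ} {p : MvPolynomial σ ℚ}
    (hp : p.IsHomogeneous e) (h : e < d) : p ∈ degreeLT σ d :=
  _root_.mem_degreeLT.2 fun _ hm => (hp.degree_eq_of_mem_support hm).trans_lt h

theorem sub_homogeneousComponent_mem_degreeLT {d : ℕ} {p : MvPolynomial σ ℚ}
    (hp : p ∈ degreeLT σ (d + 1)) : p - homogeneousComponent d p ∈ degreeLT σ d := by
  classical
  rw [mem_degreeLT] at hp ⊢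
  intro m hm
  rw [mem_support_iff, coeff_sub, coeff_homogeneousComponent] at hm
  split_ifs at hm with h
  · simp at hm
  · have := hp m (mem_support_iff.2 (by simpa using hm))
    omega

theorem X_mul_mem_degreeLT {d : ℕ} {p : MvPolynomial σ ℚ} (i : σ) (hp : p ∈ degreeLT σ d) :
    X i * p ∈ degreeLT σ (d + 1) := by
  rw [mem_degreeLT] at hp ⊢
  intro m hm
  rw [support_X_mul, Finset.mem_map] at hm
  obtain ⟨m, hm, rfl⟩ := hm
  have := hp m hm
  simp only [addLeftEmbedding_apply, map_add, Finsupp.degree_single]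
  omega

theorem homogeneousComponent_zero_X_mul (i : σ) (p : MvPolynomial σ ℚ) :
    homogeneousComponent 0 (X i * p) = 0 := by
  simp [homogeneousComponent_zero, ← constantCoeff_eq]

theorem homogeneousComponent_succ_X_mul (d : ℕ) (i : σ) (p : MvPolynomial σ ℚ) :
    homogeneousComponent (d + 1) (X i * p) = X i * homogeneousComponent d p := by
  classical
  ext m
  simp only [coeff_homogeneousComponent, coeff_X_mul']
  by_cases hi : i ∈ m.support
  · have hle : Finsupp.single i 1 ≤ m := by
      rw [Finsupp.single_le_iff]
      exact Nat.one_le_iff_ne_zero.2 (Finsupp.mem_support_iff.1 hi)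
    have hdeg : m.degree = (m - Finsupp.single i 1).degree + 1 := by
      conv_lhs => rw [← tsub_add_cancel_of_le hle, map_add, Finsupp.degree_single]
    simp [hi, hdeg]
  · simp [hi]

/-- If every generator of an ideal is the leading form of an element of `J`, so is every
homogeneous component of every element of the ideal. -/
theorem exists_add_mem_of_mem_span {G : Set (MvPolynomial σ ℚ)} {J : Ideal (MvPolynomial σ ℚ)}
    (hG : ∀ g ∈ G, ∃ e, g.IsHomogeneous e ∧ ∃ r ∈ degreeLT σ e, g + r ∈ J)
    {p : MvPolynomial σ ℚ} (hp : p ∈ Ideal.span G) (d : ℕ) :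
    ∃ r ∈ degreeLT σ d, homogeneousComponent d p + r ∈ J := by
  induction hp using Submodule.span_induction generalizing d with
  | mem g hg =>
    obtain ⟨e, he, r, hr, hgr⟩ := hG g hg
    rw [homogeneousComponent_of_mem ((mem_homogeneousSubmodule _ _).2 he)]
    split_ifs with h
    · subst h
      exact ⟨r, hr, hgr⟩
    · exact ⟨0, Submodule.zero_mem _, by simp⟩
  | zero => exact ⟨0, Submodule.zero_mem _, by simp⟩
  | add p q _ _ hp hq =>
    obtain ⟨r, hr, hpr⟩ := hp d
    obtain ⟨s, hs, hqs⟩ := hq d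
    refine ⟨r + s, Submodule.add_mem _ hr hs, ?_⟩
    rw [map_add, add_add_add_comm]
    exact J.add_mem hpr hqs
  | smul a p _ hp =>
    rw [smul_eq_mul]
    clear * - hp
    induction a using MvPolynomial.induction_on generalizing p d with
    | C c =>
      obtain ⟨r, hr, hpr⟩ := hp d
      refine ⟨c • r, Submodule.smul_mem _ _ hr, ?_⟩
      rw [C_mul', map_smul, ← smul_add, ← C_mul']
      exact J.mul_mem_left _ hpr
    | add a b ha hb =>
      obtain ⟨r, hr, hpr⟩ := ha p hp d
      obtain ⟨s, hs, hqs⟩ := hb p hp d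
      refine ⟨r + s, Submodule.add_mem _ hr hs, ?_⟩
      rw [add_mul, map_add, add_add_add_comm]
      exact J.add_mem hpr hqs
    | mul_X a i ha =>
      rw [mul_assoc]
      refine ha (X i * p) (fun d => ?_) d
      cases d with
      | zero => exact ⟨0, Submodule.zero_mem _, by
        rw [homogeneousComponent_zero_X_mul, add_zero]
        exact J.zero_mem⟩
      | succ d =>
        obtain ⟨r, hr, hpr⟩ := hp d
        refine ⟨X i * r, X_mul_mem_degreeLT i hr, ?_⟩
        rw [homogeneousComponent_succ_X_mul, ← mul_add]
        exact J.mul_mem_left _ hpr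

/-- A homogeneous spanning set of a graded quotient, not larger than a finite point set on which
lifts of the generators vanish, is linearly independent in the quotient. -/
theorem linearIndependent_mk_of_deformation {ι κ : Type*} [Fintype ι] [Fintype κ]
    {G : Set (MvPolynomial σ ℚ)} (φ : MvPolynomial σ ℚ →ₐ[ℚ] (κ → ℚ))
    (hφ : Function.Surjective φ)
    (hG : ∀ g ∈ G, ∃ e, g.IsHomogeneous e ∧ ∃ r ∈ degreeLT σ e, g + r ∈ RingHom.ker φ)
    (f : ι → MvPolynomial σ ℚ) (deg : ι → ℕ) (hf : ∀ i, (f i).IsHomogeneous (deg i))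
    (hspan : ∀ d (p : MvPolynomial σ ℚ), p.IsHomogeneous d →
      p ∈ Submodule.span ℚ (f '' {i | deg i = d}) ⊔ (Ideal.span G).restrictScalars ℚ)
    (hcard : Fintype.card ι ≤ Fintype.card κ) :
    LinearIndependent ℚ fun i => Ideal.Quotient.mk (Ideal.span G) (f i) := by
  classical
  have lower : ∀ d, ∀ p ∈ degreeLT σ d,
      φ p ∈ Submodule.span ℚ ((fun i => φ (f i)) '' {i | deg i < d}) := by
    intro d
    induction d with
    | zero =>
      intro p hp
      have : p = 0 := by
        rw [← support_eq_empty, Finset.eq_empty_iff_forall_notMem]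
        exact fun m hm => Nat.not_lt_zero _ (mem_degreeLT.1 hp m hm)
      rw [this, map_zero]
      exact Submodule.zero_mem _
    | succ d ih =>
      intro p hp
      have mono : Submodule.span ℚ ((fun i => φ (f i)) '' {i | deg i < d}) ≤
          Submodule.span ℚ ((fun i => φ (f i)) '' {i | deg i < d + 1}) :=
        Submodule.span_mono (Set.image_mono fun i (hi : deg i < d) => Nat.lt_succ_of_lt hi)
      have hhom := homogeneousComponent_isHomogeneous d p
      obtain ⟨s, hs, q, hq, hsq⟩ := Submodule.mem_sup.1 (hspan d _ hhom)
      have hs_hom : s ∈ homogeneousSubmodule σ ℚ d := by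
        refine Submodule.span_le.2 ?_ hs
        rintro _ ⟨i, rfl, rfl⟩
        exact hf i
      have hq_hom : homogeneousComponent d q = q := by
        have : q ∈ homogeneousSubmodule σ ℚ d := by
          rw [← add_sub_cancel_left s q, hsq]
          exact Submodule.sub_mem _ hhom hs_hom
        rw [homogeneousComponent_of_mem this, if_pos rfl]
      obtain ⟨r, hr, hqr⟩ := exists_add_mem_of_mem_span hG hq d
      rw [hq_hom, RingHom.mem_ker, map_add] at hqr
      have hφs : φ s ∈ Submodule.span ℚ ((fun i => φ (f i)) '' {i | deg i < d + 1}) := by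
        have := Submodule.mem_map_of_mem (f := φ.toLinearMap) hs
        rw [Submodule.map_span, ← Set.image_comp] at this
        exact Submodule.span_mono (Set.image_mono fun i (hi : deg i = d) =>
          hi.trans_lt d.lt_succ_self) this
      have : φ p = φ s - φ r + φ (p - homogeneousComponent d p) := by
        rw [← hsq, map_sub, map_add, eq_neg_of_add_eq_zero_left hqr]
        ring
      rw [this]
      exact Submodule.add_mem _ (Submodule.sub_mem _ hφs (mono (ih r hr)))
        (mono (ih _ (sub_homogeneousComponent_mem_degreeLT hp)))
  have hind : LinearIndependent ℚ fun i => φ (f i) := by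
    refine linearIndependent_of_top_le_span_of_card_le_finrank ?_ (by simpa using hcard)
    intro y _
    obtain ⟨p, rfl⟩ := hφ y
    have hp : p ∈ degreeLT σ (p.totalDegree + 1) :=
      mem_degreeLT.2 fun m hm => Nat.lt_succ_of_le (le_totalDegree hm)
    exact Submodule.span_mono (Set.image_subset_range _ _) (lower _ p hp)
  rw [Fintype.linearIndependent_iff]
  intro c hc i₀
  have hmem : ∑ i, c i • f i ∈ Ideal.span G := by
    rw [← Ideal.Quotient.eq_zero_iff_mem, map_sum, ← hc]
    rfl
  obtain ⟨r, hr, hpr⟩ := exists_add_mem_of_mem_span hG hmem (deg i₀)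
  have hcomp : homogeneousComponent (deg i₀) (∑ i, c i • f i) =
      ∑ i with deg i = deg i₀, c i • f i := by
    rw [map_sum, Finset.sum_filter]
    refine Finset.sum_congr rfl fun i _ => ?_
    rw [map_smul, homogeneousComponent_of_mem ((mem_homogeneousSubmodule _ _).2 (hf i))]
    by_cases h : deg i = deg i₀
    · simp [h]
    · rw [if_neg h, if_neg (Ne.symm h), smul_zero]
  rw [hcomp, RingHom.mem_ker, map_add, map_sum] at hpr
  simp only [map_smul] at hpr
  have h₁ : ∑ i with deg i = deg i₀, c i • φ (f i) ∈
      Submodule.span ℚ ((fun i => φ (f i)) '' {i | deg i = deg i₀}) :=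
    Submodule.sum_mem _ fun i hi => Submodule.smul_mem _ _
      (Submodule.subset_span ⟨i, (Finset.mem_filter.1 hi).2, rfl⟩)
  have h₂ : ∑ i with deg i = deg i₀, c i • φ (f i) ∈
      Submodule.span ℚ ((fun i => φ (f i)) '' {i | deg i < deg i₀}) := by
    rw [eq_neg_of_add_eq_zero_left hpr]
    exact Submodule.neg_mem _ (lower _ r hr)
  have hdisj : Disjoint {i | deg i = deg i₀} {i | deg i < deg i₀} :=
    Set.disjoint_left.2 fun i (h : deg i = _) (h' : deg i < _) => h'.ne h
  have hzero := Submodule.disjoint_def.1 (hind.disjoint_span_image hdisj) _ h₁ h₂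
  exact linearIndependent_iff'.1 hind _ c hzero i₀ (by simp)

end Deformation

section Points

variable {n k : ℕ}

/-- The surjections `Fin n → Fin k`, viewed as points of affine space. -/
abbrev SurjPoint (n k : ℕ) : Type := {f : Fin n → Fin k // Function.Surjective f}

/-- Restriction of polynomials to the point set `SurjPoint n k`. -/
noncomputable def evalPoints (n k : ℕ) : MvPolynomial (Fin n) ℚ →ₐ[ℚ] (SurjPoint n k → ℚ) :=
  AlgHom.pi fun y => aeval fun i => ((y.1 i : ℕ) : ℚ)

theorem evalPoints_apply (p : MvPolynomial (Fin n) ℚ) (y : SurjPoint n k) :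
    evalPoints n k p y = aeval (fun i => ((y.1 i : ℕ) : ℚ)) p := rfl

theorem evalPoints_surjective : Function.Surjective (evalPoints n k) := by
  rw [← AlgHom.coe_toLinearMap, ← LinearMap.range_eq_top, eq_top_iff,
    ← (Pi.basisFun ℚ (SurjPoint n k)).span_eq, Submodule.span_le]
  rintro _ ⟨y, rfl⟩
  let p : MvPolynomial (Fin n) ℚ :=
    ∏ i, ∏ a ∈ Finset.univ.erase (y.1 i), (X i - C ((a : ℕ) : ℚ))
  have hp : ∀ z, evalPoints n k p z =
      ∏ i, ∏ a ∈ Finset.univ.erase (y.1 i), (((z.1 i : ℕ) : ℚ) - ((a : ℕ) : ℚ)) := fun z => by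
    simp [p, evalPoints_apply, map_prod]
  have hy : evalPoints n k p y ≠ 0 := by
    rw [hp]
    refine Finset.prod_ne_zero_iff.2 fun i _ => Finset.prod_ne_zero_iff.2 fun a ha => ?_
    rw [sub_ne_zero, Ne, Nat.cast_inj, ← Fin.ext_iff]
    exact (Finset.ne_of_mem_erase ha).symm
  refine ⟨(evalPoints n k p y)⁻¹ • p, ?_⟩
  ext z
  rw [AlgHom.toLinearMap_apply, map_smul, Pi.smul_apply, Pi.basisFun_apply, smul_eq_mul]
  by_cases hz : z = y
  · subst hz
    rw [inv_mul_cancel₀ hy, Pi.single_eq_same]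
  · rw [Pi.single_eq_of_ne hz]
    obtain ⟨i, hi⟩ := Function.ne_iff.1 (Subtype.coe_injective.ne hz)
    rw [hp z, Finset.prod_eq_zero (Finset.mem_univ i), mul_zero]
    exact Finset.prod_eq_zero (Finset.mem_erase.2 ⟨hi, Finset.mem_univ _⟩) (sub_self _)

theorem exists_X_pow_add_mem_ker (i : Fin n) :
    ∃ r ∈ degreeLT (Fin n) k, X i ^ k + r ∈ RingHom.ker (evalPoints n k) := by
  let q : Polynomial ℚ := ∏ a : Fin k, (Polynomial.X - Polynomial.C ((a : ℕ) : ℚ))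
  have hmonic : q.Monic := Polynomial.monic_prod_X_sub_C _ _
  have hdeg : q.natDegree = k := by
    rw [Polynomial.natDegree_prod_of_monic _ _ fun _ _ => Polynomial.monic_X_sub_C _]
    simp only [Polynomial.natDegree_X_sub_C, Finset.sum_const, Finset.card_univ, Fintype.card_fin,
      smul_eq_mul, mul_one]
  refine ⟨∑ j ∈ Finset.range k, C (q.coeff j) * X i ^ j, Submodule.sum_mem _ fun j hj => ?_, ?_⟩
  · refine MvPolynomial.IsHomogeneous.mem_degreeLT (e := j) ?_ (Finset.mem_range.1 hj)
    simpa using (isHomogeneous_C (Fin n) (q.coeff j)).mul (isHomogeneous_X_pow i j)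
  · have hq : X i ^ k + ∑ j ∈ Finset.range k, C (q.coeff j) * X i ^ j =
        Polynomial.aeval (X i : MvPolynomial (Fin n) ℚ) q := by
      rw [Polynomial.aeval_eq_sum_range, hdeg, Finset.sum_range_succ, add_comm]
      conv_rhs => rw [← hdeg, hmonic.coeff_natDegree, one_smul, hdeg]
      simp [C_mul']
    rw [hq, RingHom.mem_ker]
    ext y
    simp only [q, map_prod, evalPoints_apply, Pi.zero_apply]
    exact Finset.prod_eq_zero (Finset.mem_univ (y.1 i)) (by simp)

theorem coeff_prod_one_add (y : Fin n → ℚ) (d : ℕ) :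
    (∏ i, (1 + Polynomial.C (y i) * Polynomial.X)).coeff d = aeval y (esymm (Fin n) ℚ d) := by
  rw [Finset.prod_one_add, Polynomial.finsetSum_coeff, esymm, map_sum,
    Finset.powersetCard_eq_filter, Finset.sum_filter]
  refine Finset.sum_congr rfl fun S _ => ?_
  rw [Finset.prod_mul_distrib, Finset.prod_const, ← map_prod, Polynomial.coeff_C_mul_X_pow,
    map_prod]
  simp [eq_comm]

theorem isHomogeneous_esymm (d : ℕ) : (esymm (Fin n) ℚ d).IsHomogeneous d := by
  refine IsHomogeneous.sum _ _ _ fun S hS => ?_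
  have := IsHomogeneous.prod S (fun i => (X i : MvPolynomial (Fin n) ℚ)) (fun _ => 1)
    fun i _ => isHomogeneous_X _ i
  simpa [(Finset.mem_powersetCard.1 hS).2] using this

theorem exists_esymm_add_mem_ker {d : ℕ} (hd : n - k + 1 ≤ d) :
    ∃ r ∈ degreeLT (Fin n) d, esymm (Fin n) ℚ d + r ∈ RingHom.ker (evalPoints n k) := by
  let P : Polynomial ℚ := ∏ a : Fin k, (1 + Polynomial.C ((a : ℕ) : ℚ) * Polynomial.X)
  let H : PowerSeries ℚ := (P : PowerSeries ℚ)⁻¹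
  have hP : PowerSeries.constantCoeff (P : PowerSeries ℚ) = 1 := by
    simp [P, Polynomial.coeff_zero_prod]
  have hH : PowerSeries.coeff 0 H = 1 := by
    simp [H, hP]
  refine ⟨∑ j ∈ Finset.range d, C (PowerSeries.coeff (d - j) H) * esymm (Fin n) ℚ j,
    Submodule.sum_mem _ fun j hj => ?_, ?_⟩
  · refine MvPolynomial.IsHomogeneous.mem_degreeLT (e := j) ?_ (Finset.mem_range.1 hj)
    simpa using (isHomogeneous_C (Fin n) _).mul (isHomogeneous_esymm (n := n) j)
  rw [RingHom.mem_ker]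
  ext y
  let s := Function.surjInv y.2
  have hs : Function.Injective s := Function.injective_surjInv y.2
  let T : Finset (Fin n) := Finset.univ.map ⟨s, hs⟩
  let Q : Polynomial ℚ := ∏ i ∈ Tᶜ, (1 + Polynomial.C ((y.1 i : ℕ) : ℚ) * Polynomial.X)
  have hPQ : ∏ i, (1 + Polynomial.C ((y.1 i : ℕ) : ℚ) * Polynomial.X) = P * Q := by
    rw [← Finset.prod_mul_prod_compl T]
    congr 1
    simp only [T, Finset.prod_map, Function.Embedding.coeFn_mk, s, Function.surjInv_eq, P]
  have hQ : Q.natDegree ≤ n - k := by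
    refine (Polynomial.natDegree_prod_le _ _).trans ?_
    refine (Finset.sum_le_card_nsmul _ _ 1 fun i _ => ?_).trans ?_
    · compute_degree
    · simp [T, Finset.card_compl]
  have hcoeff : PowerSeries.coeff d (((P * Q : Polynomial ℚ) : PowerSeries ℚ) * H) = 0 := by
    rw [Polynomial.coe_mul, mul_right_comm, PowerSeries.mul_inv_cancel _ (by simp [hP]), one_mul,
      Polynomial.coeff_coe]
    exact Polynomial.coeff_eq_zero_of_natDegree_lt (by omega)
  rw [← hPQ, PowerSeries.coeff_mul, Finset.Nat.sum_antidiagonal_eq_sum_range_succ_mk,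
    Finset.sum_range_succ] at hcoeff
  simp only [Polynomial.coeff_coe, coeff_prod_one_add, Nat.sub_self, hH, mul_one] at hcoeff
  rw [evalPoints_apply, map_add, map_sum, Pi.zero_apply, add_comm, ← hcoeff]
  simp [mul_comm]

end Points

section Injection

variable {n k : ℕ}

theorem Nat.exists_eq_of_le_of_succ_le {f : ℕ → ℕ} {N t : ℕ} (h₀ : f 0 = 0)
    (hstep : ∀ p < N, f (p + 1) ≤ f p + 1) (ht : t ≤ f N) : ∃ p ≤ N, f p = t := by
  induction N with
  | zero => exact ⟨0, le_rfl, by omega⟩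
  | succ N ih =>
    rcases ht.eq_or_lt with rfl | ht
    · exact ⟨N + 1, le_rfl, rfl⟩
    · have := hstep N N.lt_succ_self
      obtain ⟨p, hp, hpt⟩ := ih (fun p hp => hstep p (Nat.lt_succ_of_lt hp)) (by omega)
      exact ⟨p, Nat.le_succ_of_le hp, hpt⟩

/-- The number of positions before `p` which are not descents of `π`. -/
def ascBefore (π : Equiv.Perm (Fin n)) (p : ℕ) : ℕ :=
  (Finset.univ.filter fun q : Fin n => (q : ℕ) < p ∧ q ∉ desSet π).card

theorem ascBefore_zero (π : Equiv.Perm (Fin n)) : ascBefore π 0 = 0 := by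
  simp [ascBefore]

theorem ascBefore_succ (π : Equiv.Perm (Fin n)) (p : Fin n) :
    ascBefore π (p + 1) = ascBefore π p + if p ∈ desSet π then 0 else 1 := by
  have key : (Finset.univ.filter fun q : Fin n => (q : ℕ) < p + 1 ∧ q ∉ desSet π) =
      (Finset.univ.filter fun q : Fin n => (q : ℕ) < p ∧ q ∉ desSet π) ∪
        if p ∈ desSet π then ∅ else {p} := by
    ext q
    have hq : (q : ℕ) < p + 1 ↔ (q : ℕ) < p ∨ q = p := by rw [Fin.ext_iff]; omega
    split_ifs <;> simp only [Finset.mem_filter, Finset.mem_univ, Finset.mem_union,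
      Finset.notMem_empty, Finset.mem_singleton, hq] <;> grind
  rw [ascBefore, key, Finset.card_union_of_disjoint, ascBefore]
  · split_ifs <;> simp
  · split_ifs <;> simp

theorem ascBefore_pred (π : Equiv.Perm (Fin n)) (hn : 0 < n) :
    ascBefore π (n - 1) + 1 + (desSet π).card = n := by
  have hlast : (⟨n - 1, by omega⟩ : Fin n) ∉ desSet π := fun h => by
    have := val_add_one_lt_of_mem_desSet h
    dsimp only at this
    omega
  have h₁ := ascBefore_succ π ⟨n - 1, by omega⟩
  rw [if_neg hlast] at h₁
  dsimp only at h₁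
  have h₂ : ascBefore π (n - 1 + 1) = (desSet π)ᶜ.card := by
    rw [ascBefore]
    congr 1
    ext q
    simp only [Finset.mem_filter, Finset.mem_univ, true_and, Finset.mem_compl]
    have := q.isLt
    grind
  have h₃ := Finset.card_add_card_compl (desSet π)
  rw [Fintype.card_fin] at h₃
  omega

/-- The `j`-th part of `v`, shifted by a staircase so that the parts become distinct. -/
def shiftedPart (v : Fin (n - k) → ℕ) (j : Fin (n - k)) : ℕ := v j + (n - k - 1 - j)

theorem shiftedPart_strictAnti {v : Fin (n - k) → ℕ}
    (hv : ∀ a b : Fin (n - k), a ≤ b → v b ≤ v a) : StrictAnti (shiftedPart v) := by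
  intro a b hab
  have := hv a b hab.le
  rw [Fin.lt_def] at hab
  simp only [shiftedPart]
  omega

theorem shiftedPart_lt (hkn : k ≤ n) (x : GSIndex n k) (j : Fin (n - k)) :
    shiftedPart x.1.2 j < ascBefore x.1.1 (n - 1) := by
  have := x.2.2.2 j
  have := ascBefore_pred x.1.1 (by omega)
  simp only [shiftedPart]
  omega

/-- The number of shifted parts of `v` below `t`. -/
def partsBelow (v : Fin (n - k) → ℕ) (t : ℕ) : ℕ :=
  (Finset.univ.filter fun j => shiftedPart v j < t).card

theorem partsBelow_succ {v : Fin (n - k) → ℕ}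
    (hv : ∀ a b : Fin (n - k), a ≤ b → v b ≤ v a) (t : ℕ)
    [Decidable (t ∈ Set.range (shiftedPart v))] :
    partsBelow v (t + 1) = partsBelow v t + if t ∈ Set.range (shiftedPart v) then 1 else 0 := by
  have hinj := (shiftedPart_strictAnti hv).injective
  have key : (Finset.univ.filter fun j => shiftedPart v j < t + 1) =
      (Finset.univ.filter fun j => shiftedPart v j < t) ∪
        Finset.univ.filter fun j => shiftedPart v j = t := by
    ext j
    simp only [Finset.mem_filter, Finset.mem_univ, Finset.mem_union, true_and]
    omega
  rw [partsBelow, key, Finset.card_union_of_disjoint, partsBelow]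
  · congr 1
    split_ifs with h
    · obtain ⟨j, rfl⟩ := h
      simp [hinj.eq_iff, Finset.filter_eq']
    · rw [Finset.card_eq_zero, Finset.filter_eq_empty_iff]
      exact fun j _ hj => h ⟨j, hj⟩
  · rw [Finset.disjoint_filter]
    intro j _ h₁ h₂
    omega

/-- The index of the block containing position `p` in the ordered set partition encoded by `x`:
the number of block boundaries before `p`. -/
def blockIndex (x : GSIndex n k) (p : ℕ) : ℕ := p - partsBelow x.1.2 (ascBefore x.1.1 p)

theorem partsBelow_ascBefore_zero (x : GSIndex n k) :
    partsBelow x.1.2 (ascBefore x.1.1 0) = 0 := by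
  simp [partsBelow, ascBefore_zero]

theorem partsBelow_ascBefore_succ (x : GSIndex n k) (p : Fin n) :
    partsBelow x.1.2 (ascBefore x.1.1 (p + 1)) = partsBelow x.1.2 (ascBefore x.1.1 p) ∨
      partsBelow x.1.2 (ascBefore x.1.1 (p + 1)) = partsBelow x.1.2 (ascBefore x.1.1 p) + 1 ∧
        p ∉ desSet x.1.1 := by
  classical
  rw [ascBefore_succ]
  split_ifs with h
  · exact Or.inl rfl
  · rw [partsBelow_succ x.2.2.1]
    split_ifs <;> simp [h]

theorem partsBelow_ascBefore_le (x : GSIndex n k) {p : ℕ} (hp : p ≤ n) :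
    partsBelow x.1.2 (ascBefore x.1.1 p) ≤ p := by
  induction p with
  | zero => exact (partsBelow_ascBefore_zero x).le
  | succ p ih =>
    have := ih (by omega)
    have := partsBelow_ascBefore_succ x ⟨p, hp⟩
    dsimp only at this
    omega

theorem blockIndex_add (x : GSIndex n k) {p : ℕ} (hp : p ≤ n) :
    blockIndex x p + partsBelow x.1.2 (ascBefore x.1.1 p) = p :=
  Nat.sub_add_cancel (partsBelow_ascBefore_le x hp)

theorem blockIndex_succ (x : GSIndex n k) (p : Fin n) :
    blockIndex x (p + 1) = blockIndex x p + 1 ∨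
      blockIndex x (p + 1) = blockIndex x p ∧ p ∉ desSet x.1.1 := by
  have h₁ := blockIndex_add x (p := p) (by omega)
  have h₂ := blockIndex_add x (p := p + 1) (by omega)
  rcases partsBelow_ascBefore_succ x p with h | ⟨h, h'⟩
  · exact Or.inl (by omega)
  · exact Or.inr ⟨by omega, h'⟩

theorem blockIndex_pred (hk : 1 ≤ k) (hkn : k ≤ n) (x : GSIndex n k) :
    blockIndex x (n - 1) = k - 1 := by
  have h : partsBelow x.1.2 (ascBefore x.1.1 (n - 1)) = n - k := by
    rw [partsBelow, Finset.filter_true_of_mem fun j _ => shiftedPart_lt hkn x j]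
    simp
  rw [blockIndex, h]
  omega

/-- Block index first, then element: increasing along the word of `x`. -/
theorem strictMono_blockIndex_lex (x : GSIndex n k) :
    StrictMono fun p : Fin n => toLex (blockIndex x p, x.1.1 p) := by
  refine Monotone.strictMono_of_injective (fun p q hpq => ?_) fun p q h => ?_
  · refine Fin.rel_of_le_of_adjacent
      (R := fun p q => toLex (blockIndex x p, x.1.1 p) ≤ toLex (blockIndex x q, x.1.1 q))
      (fun _ => le_rfl) (fun _ _ _ => le_trans) (fun p q hadj => ?_) hpq
    rw [Prod.Lex.toLex_le_toLex]
    dsimp only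
    rw [hadj]
    rcases blockIndex_succ x p with h | ⟨h, h'⟩
    · exact Or.inl (by omega)
    · exact Or.inr ⟨h.symm, not_lt.1 ((mem_desSet_iff hadj).not.1 h')⟩
  · exact x.1.1.injective (congrArg (fun z => (ofLex z).2) h)

theorem blockIndex_lt (hk : 1 ≤ k) (hkn : k ≤ n) (x : GSIndex n k) (p : Fin n) :
    blockIndex x p < k := by
  have hle : p ≤ ⟨n - 1, by omega⟩ := by rw [Fin.le_def]; dsimp only; omega
  have := (strictMono_blockIndex_lex x).monotone hle
  rw [Prod.Lex.toLex_le_toLex] at this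
  dsimp only at this
  rw [blockIndex_pred hk hkn x] at this
  omega

/-- The ordered set partition encoded by an index, as a surjection. -/
def toSurjPoint (hk : 1 ≤ k) (hkn : k ≤ n) (x : GSIndex n k) : SurjPoint n k :=
  ⟨fun i => ⟨blockIndex x (x.1.1.symm i), blockIndex_lt hk hkn x _⟩, fun t => by
    obtain ⟨p, hp, hpt⟩ := Nat.exists_eq_of_le_of_succ_le (f := blockIndex x) (N := n - 1) (t := t)
      (by simp [blockIndex])
      (fun p hp => by
        have := blockIndex_succ x ⟨p, by omega⟩
        dsimp only at this
        omega)
      (by rw [blockIndex_pred hk hkn x]; omega)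
    exact ⟨x.1.1 ⟨p, by omega⟩, Fin.ext (by simpa using hpt)⟩⟩

theorem toSurjPoint_injective (hk : 1 ≤ k) (hkn : k ≤ n) :
    Function.Injective (toSurjPoint (n := n) hk hkn) := by
  classical
  intro x y hxy
  have hval : ∀ i, blockIndex x (x.1.1.symm i) = blockIndex y (y.1.1.symm i) := fun i =>
    congrArg (fun z : SurjPoint n k => (z.1 i : ℕ)) hxy
  have hrange : ∀ z : GSIndex n k, Set.range (fun p : Fin n => toLex (blockIndex z p, z.1.1 p)) =
      Set.range fun i => toLex (blockIndex z (z.1.1.symm i), i) := fun z => by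
    rw [← z.1.1.surjective.range_comp fun i => toLex (blockIndex z (z.1.1.symm i), i)]
    simp [Function.comp_def]
  have heq := ((strictMono_blockIndex_lex x).range_inj (strictMono_blockIndex_lex y)).1
    (by rw [hrange, hrange]; simp only [hval])
  have hπ : x.1.1 = y.1.1 := Equiv.ext fun p => congrArg (fun z => (ofLex z).2) (congrFun heq p)
  have hblock : ∀ p : Fin n, blockIndex x p = blockIndex y p := fun p =>
    congrArg (fun z => (ofLex z).1) (congrFun heq p)
  have hparts : ∀ t ≤ ascBefore x.1.1 (n - 1), partsBelow x.1.2 t = partsBelow y.1.2 t := by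
    intro t ht
    obtain ⟨p, hp, rfl⟩ := Nat.exists_eq_of_le_of_succ_le (ascBefore_zero x.1.1)
      (fun p hp => by
        have := ascBefore_succ x.1.1 ⟨p, by omega⟩
        dsimp only at this
        split_ifs at this <;> omega) ht
    have h₁ := blockIndex_add x (p := p) (by omega)
    have h₂ := blockIndex_add y (p := p) (by omega)
    have h₃ := hblock ⟨p, by omega⟩
    rw [← hπ] at h₂
    dsimp only at h₃
    omega
  have hmem : ∀ t < ascBefore x.1.1 (n - 1),
      (t ∈ Set.range (shiftedPart x.1.2) ↔ t ∈ Set.range (shiftedPart y.1.2)) := by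
    intro t ht
    have h₁ := partsBelow_succ x.2.2.1 t
    have h₂ := partsBelow_succ y.2.2.1 t
    rw [← hparts _ ht, ← hparts _ ht.le, h₁] at h₂
    split_ifs at h₂ with h₃ h₄ h₄ <;>
      first | omega | exact iff_of_true h₃ h₄ | exact iff_of_false h₃ h₄
  have hshift : shiftedPart x.1.2 = shiftedPart y.1.2 := by
    refine ((shiftedPart_strictAnti x.2.2.1).range_inj (shiftedPart_strictAnti y.2.2.1)).1 ?_
    ext t
    by_cases ht : t < ascBefore x.1.1 (n - 1)
    · exact hmem t ht
    · refine iff_of_false ?_ ?_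
      · rintro ⟨j, rfl⟩
        exact ht (shiftedPart_lt hkn x j)
      · rintro ⟨j, rfl⟩
        exact ht (hπ ▸ shiftedPart_lt hkn y j)
  refine Subtype.ext (Prod.ext hπ (funext fun j => ?_))
  exact Nat.add_right_cancel (congrFun hshift j)

end Injection

theorem gsPoly_eq_monomial {n k : ℕ} (x : GSIndex n k) :
    ∃ a : Fin n →₀ ℕ, gsPoly x = monomial a 1 :=
  ⟨Finsupp.equivFunOnFinite.symm fun i => (((desSet x.1.1).filter (x.1.1.symm i ≤ ·)).card +
      if h : (x.1.1.symm i : ℕ) < n - k then x.1.2 ⟨x.1.1.symm i, h⟩ else 0),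
    prod_X_perm_pow _ _ _ fun j => by simp⟩

theorem isHomogeneous_gsPoly {n k : ℕ} (x : GSIndex n k) :
    (gsPoly x).IsHomogeneous (gsPoly x).totalDegree := by
  obtain ⟨a, ha⟩ := gsPoly_eq_monomial x
  rw [ha, totalDegree_monomial _ one_ne_zero]
  exact isHomogeneous_monomial _ rfl

theorem MvPolynomial.mem_of_monomial_mem {σ : Type*} {M : Submodule ℚ (MvPolynomial σ ℚ)}
    {p : MvPolynomial σ ℚ} (h : ∀ m ∈ p.support, monomial m 1 ∈ M) : p ∈ M := by
  rw [p.as_sum]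
  refine Submodule.sum_mem _ fun m hm => ?_
  rw [← mul_one (coeff m p), ← smul_eq_mul, ← smul_monomial]
  exact Submodule.smul_mem _ _ (h m hm)

/-- The generalized Garsia–Stanton monomials descend to a `ℚ`-basis of `R_{n,k}`:
the family (indexed by the pairs `(π, v)`) is linearly independent and spans. -/
theorem stmt12 (n k : ℕ) (hk : 1 ≤ k) (hkn : k ≤ n) :
    LinearIndependent ℚ (fun x : GSIndex n k =>
      Ideal.Quotient.mk (Ink n k) (gsMon n k x.1.1 x.1.2)) ∧
    Submodule.span ℚ (Set.range fun x : GSIndex n k =>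
      Ideal.Quotient.mk (Ink n k) (gsMon n k x.1.1 x.1.2)) = ⊤ := by
  classical
  have : Finite (GSIndex n k) := Finite.of_injective _ (toSurjPoint_injective hk hkn)
  have : Fintype (GSIndex n k) := Fintype.ofFinite _
  constructor
  · refine linearIndependent_mk_of_deformation (evalPoints n k) evalPoints_surjective ?_ gsPoly
      (fun x => (gsPoly x).totalDegree) isHomogeneous_gsPoly (fun d p hp => ?_)
      (Fintype.card_le_of_injective _ (toSurjPoint_injective hk hkn))
    · rintro _ (⟨i, rfl⟩ | ⟨d, hd, -, rfl⟩)
      · exact ⟨k, isHomogeneous_X_pow i k, exists_X_pow_add_mem_ker i⟩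
      · exact ⟨d, isHomogeneous_esymm d, exists_esymm_add_mem_ker hd⟩
    · refine mem_of_monomial_mem fun m hm => ?_
      rw [← hp.degree_eq_of_mem_support hm]
      exact monomial_mem_span_gsPoly_sup hk m
  · rw [eq_top_iff]
    intro q _
    obtain ⟨p, rfl⟩ := Ideal.Quotient.mk_surjective q
    have hp : p ∈ Submodule.span ℚ (Set.range (gsPoly (n := n) (k := k))) ⊔
        (Ink n k).restrictScalars ℚ :=
      mem_of_monomial_mem fun m _ => by
        refine SetLike.le_def.1 (sup_le_sup_right ?_ _) (monomial_mem_span_gsPoly_sup hk m)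
        exact Submodule.span_mono (Set.image_subset_range _ _)
    obtain ⟨s, hs, r, hr, rfl⟩ := Submodule.mem_sup.1 hp
    rw [map_add, Ideal.Quotient.eq_zero_iff_mem.2 hr, add_zero]
    have := Submodule.mem_map_of_mem (f := (Ideal.Quotient.mkₐ ℚ (Ink n k)).toLinearMap) hs
    rwa [Submodule.map_span, ← Set.range_comp] at this
end

section
/- Let s ≤ k ≤ n be positive integers. There exists a ℚ-linear bijection between R_{n,k,s} and the free ℚ-vector space with basis the set of functions f : {1, …, n} → {1, …, k} whose image contains {1, …, s}, intertwining the S_n-action on R_{n,k,s} induced by variable permutation x_i ↦ x_{σ(i)} (well defined since I_{n,k,s} is stable under variable permutations) with the action on basis elements given by f ↦ f ∘ σ^{−1}. In other words, R_{n,k,s} ≅ ℚ[OP_{n,k,s}] as ungraded S_n-modules. -/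
open MvPolynomial

/-- The ideal `I_{n,k,s} ⊆ ℚ[x_1, …, x_n]` generated by `x_1^k, …, x_n^k` together with
the elementary symmetric polynomials `e_d(x_1, …, x_n)` for `n−s+1 ≤ d ≤ n`. -/
noncomputable def Inks (n k s : ℕ) : Ideal (MvPolynomial (Fin n) ℚ) :=
  Ideal.span ({p | ∃ i : Fin n, p = X i ^ k} ∪
    {p | ∃ d : ℕ, n - s + 1 ≤ d ∧ d ≤ n ∧ p = esymm (Fin n) ℚ d})

/-- The ideal generated by the `X i ^ k` and the elementary symmetric polynomials `e_d` with
`d > n - s`, where the difference is taken in `ℤ`; for `s > n` it is the unit ideal. -/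
noncomputable def powEsymmIdeal (n k s : ℕ) : Ideal (MvPolynomial (Fin n) ℚ) :=
  Ideal.span ({p | ∃ i : Fin n, p = X i ^ k} ∪
    {p | ∃ d : ℕ, n + 1 ≤ d + s ∧ p = esymm (Fin n) ℚ d})

lemma esymm_eq_zero_of_lt {n d : ℕ} (h : n < d) : esymm (Fin n) ℚ d = 0 := by
  rw [esymm, Finset.powersetCard_eq_empty.2 (by simpa using h), Finset.sum_empty]

lemma powEsymmIdeal_eq_Inks {n k s : ℕ} (h : s ≤ n) : powEsymmIdeal n k s = Inks n k s := by
  apply le_antisymm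
  · refine Ideal.span_le.2 ?_
    rintro p (⟨i, rfl⟩ | ⟨d, hd, rfl⟩)
    · exact Ideal.subset_span (Or.inl ⟨i, rfl⟩)
    · by_cases hdn : d ≤ n
      · exact Ideal.subset_span (Or.inr ⟨d, by omega, hdn, rfl⟩)
      · rw [esymm_eq_zero_of_lt (by omega)]
        exact Ideal.zero_mem _
  · refine Ideal.span_mono (Set.union_subset_union_right _ ?_)
    rintro p ⟨d, hd, -, rfl⟩
    exact ⟨d, by omega, rfl⟩

lemma esymm_fin_succ (n d : ℕ) :
    esymm (Fin (n + 1)) ℚ (d + 1) =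
      rename Fin.succ (esymm (Fin n) ℚ (d + 1)) + X 0 * rename Fin.succ (esymm (Fin n) ℚ d) := by
  have key : ∀ d, rename Fin.succ (esymm (Fin n) ℚ d) =
      ((Finset.univ : Finset (Fin n)).val.map fun i =>
        (X i.succ : MvPolynomial (Fin (n + 1)) ℚ)).esymm d := by
    intro d
    rw [Finset.esymm_map_val, esymm, map_sum]
    simp
  rw [key, key, esymm_eq_multiset_esymm, Fin.univ_succ]
  simp only [Finset.cons_val, Finset.map_val, Multiset.map_cons, Multiset.map_map,
    Multiset.esymm, Multiset.powersetCard_cons, Multiset.map_add, Multiset.sum_add,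
    Function.comp_def, Function.Embedding.coeFn_mk, Multiset.prod_cons, Multiset.sum_map_mul_left]

/-- The number of functions from an `n`-element set to a `k`-element set whose image contains a
given `s`-element subset, see `card_functions_covering`. -/
def coverCount (k : ℕ) : ℕ → ℕ → ℕ
  | 0, 0 => 1
  | 0, _ + 1 => 0
  | n + 1, s => s * coverCount k n (s - 1) + (k - s) * coverCount k n s

lemma card_functions_covering (k n : ℕ) (S : Finset (Fin k)) :
    Fintype.card {f : Fin n → Fin k // ∀ j ∈ S, ∃ i, f i = j} = coverCount k n S.card := by
  induction n generalizing S with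
  | zero =>
    rcases S.eq_empty_or_nonempty with rfl | ⟨j, hj⟩
    · simp [coverCount]
    · obtain ⟨c, hc⟩ : ∃ c, S.card = c + 1 :=
        ⟨S.card - 1, by have := Finset.card_pos.2 ⟨j, hj⟩; omega⟩
      rw [hc, coverCount, Fintype.card_eq_zero_iff]
      exact ⟨fun f => (f.2 j hj).choose.elim0⟩
  | succ n ih =>
    let e : {f : Fin (n + 1) → Fin k // ∀ j ∈ S, ∃ i, f i = j} ≃
        Σ a : Fin k, {f : Fin n → Fin k // ∀ j ∈ S.erase a, ∃ i, f i = j} :=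
      { toFun := fun f => ⟨f.1 0, fun i => f.1 i.succ, fun j hj => by
          obtain ⟨hja, hjS⟩ := Finset.mem_erase.1 hj
          obtain ⟨i, hi⟩ := f.2 j hjS
          cases i using Fin.cases with
          | zero => exact absurd hi.symm hja
          | succ i => exact ⟨i, hi⟩⟩
        invFun := fun g => ⟨Fin.cons g.1 g.2.1, fun j hj => by
          by_cases h : j = g.1
          · exact ⟨0, by simp [h]⟩
          · obtain ⟨i, hi⟩ := g.2.2 j (Finset.mem_erase.2 ⟨h, hj⟩)
            exact ⟨i.succ, by simpa using hi⟩⟩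
        left_inv := fun f => Subtype.ext (Fin.cons_self_tail f.1)
        right_inv := fun g => rfl }
    rw [Fintype.card_congr e, Fintype.card_sigma]
    simp_rw [ih]
    rw [← Finset.sum_add_sum_compl S, Finset.sum_congr rfl fun a ha => by
        rw [Finset.card_erase_of_mem ha],
      Finset.sum_congr (s₁ := Sᶜ) rfl fun a ha => by
        rw [Finset.erase_eq_of_notMem (Finset.mem_compl.1 ha)]]
    simp [coverCount, Finset.card_compl]

lemma X_pow_mul_rename_esymm_mem {n k s : ℕ} (m d : ℕ) (hs : n + 1 ≤ d + s) (hm : n + 1 ≤ d + m) :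
    X 0 ^ m * rename Fin.succ (esymm (Fin n) ℚ d) ∈ powEsymmIdeal (n + 1) k s := by
  induction m generalizing d with
  | zero => simp [esymm_eq_zero_of_lt (show n < d by omega)]
  | succ m ih =>
    have h : (X 0 ^ (m + 1) * rename Fin.succ (esymm (Fin n) ℚ d) : MvPolynomial (Fin (n + 1)) ℚ) =
        X 0 ^ m * esymm (Fin (n + 1)) ℚ (d + 1) -
          X 0 ^ m * rename Fin.succ (esymm (Fin n) ℚ (d + 1)) := by
      rw [esymm_fin_succ]; ring
    rw [h]
    exact Ideal.sub_mem _ (Ideal.mul_mem_left _ _ (Ideal.subset_span (Or.inr ⟨_, by omega, rfl⟩)))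
      (ih _ (by omega) (by omega))

lemma X_pow_mul_rename_mem_sup {n k s t i : ℕ}
    (h : t + 1 = s ∨ t = s ∧ s ≤ i) {q : MvPolynomial (Fin n) ℚ} (hq : q ∈ powEsymmIdeal n k t) :
    X 0 ^ i * rename Fin.succ q ∈ powEsymmIdeal (n + 1) k s ⊔ Ideal.span {X 0 ^ (i + 1)} := by
  induction hq using Submodule.span_induction with
  | zero => simp
  | add p q _ _ hp hq => rw [map_add, mul_add]; exact Ideal.add_mem _ hp hq
  | smul a p _ hp =>
    rw [smul_eq_mul, map_mul, mul_left_comm]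
    exact Ideal.mul_mem_left _ _ hp
  | mem p hp =>
    rcases hp with ⟨j, rfl⟩ | ⟨d, hd, rfl⟩
    · rw [map_pow, rename_X]
      exact Ideal.mul_mem_left _ _ (Ideal.mem_sup_left (Ideal.subset_span (Or.inl ⟨_, rfl⟩)))
    · rcases h with rfl | ⟨rfl, hi⟩
      · cases d with
        | zero =>
          refine Ideal.mul_mem_left _ _ (Ideal.mem_sup_left (Ideal.subset_span
            (Or.inr ⟨0, by omega, by simp⟩)))
        | succ d =>
          have h : (X 0 ^ i * rename Fin.succ (esymm (Fin n) ℚ (d + 1)) :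
              MvPolynomial (Fin (n + 1)) ℚ) = X 0 ^ i * esymm (Fin (n + 1)) ℚ (d + 1) -
                rename Fin.succ (esymm (Fin n) ℚ d) * X 0 ^ (i + 1) := by
            rw [esymm_fin_succ]; ring
          rw [h]
          exact Ideal.sub_mem _ (Ideal.mem_sup_left (Ideal.mul_mem_left _ _ (Ideal.subset_span
            (Or.inr ⟨_, by omega, rfl⟩))))
            (Ideal.mem_sup_right (Ideal.mul_mem_left _ _ (Ideal.mem_span_singleton_self _)))
      · exact Ideal.mem_sup_left (X_pow_mul_rename_esymm_mem _ _ hd (by omega))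

lemma exists_eq_rename_succ_add {n : ℕ} (p : MvPolynomial (Fin (n + 1)) ℚ) :
    ∃ p₀ q, p = rename Fin.succ p₀ + X 0 * q := by
  induction p using MvPolynomial.induction_on with
  | C a => exact ⟨C a, 0, by simp⟩
  | add p q hp hq =>
    obtain ⟨p₀, p₁, hp⟩ := hp
    obtain ⟨q₀, q₁, hq⟩ := hq
    exact ⟨p₀ + q₀, p₁ + q₁, by rw [map_add]; linear_combination hp + hq⟩
  | mul_X p i hp =>
    obtain ⟨p₀, p₁, hp⟩ := hp
    cases i using Fin.cases with
    | zero => exact ⟨0, p, by simp [mul_comm]⟩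
    | succ i =>
      exact ⟨p₀ * X i, p₁ * X i.succ, by
        rw [map_mul, rename_X]; linear_combination X i.succ * hp⟩

lemma exists_spanning_finset (k n s : ℕ) (hsk : s ≤ k) :
    ∃ B : Finset (MvPolynomial (Fin n) ℚ), B.card ≤ coverCount k n s ∧
      ∀ p, ∃ b ∈ Submodule.span ℚ (B : Set (MvPolynomial (Fin n) ℚ)),
        p - b ∈ powEsymmIdeal n k s := by
  classical
  induction n generalizing s with
  | zero =>
    cases s with
    | zero =>
      refine ⟨{1}, by simp [coverCount], fun p => ⟨p, ?_, by simp⟩⟩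
      rw [Finset.coe_singleton, Submodule.mem_span_singleton]
      exact ⟨coeff 0 p, by rw [eq_C_of_isEmpty p]; simp [smul_eq_C_mul]⟩
    | succ s =>
      refine ⟨∅, by simp, fun p => ⟨0, Submodule.zero_mem _, ?_⟩⟩
      have h1 : (1 : MvPolynomial (Fin 0) ℚ) ∈ powEsymmIdeal 0 k (s + 1) :=
        Ideal.subset_span (Or.inr ⟨0, by omega, by simp⟩)
      simpa using Ideal.mul_mem_left _ p h1
  | succ n ih =>
    obtain ⟨B, hB, hBs⟩ := ih (s - 1) (by omega)
    obtain ⟨B', hB', hBs'⟩ := ih s hsk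
    let A : ℕ → Finset (MvPolynomial (Fin n) ℚ) := fun i => if i < s then B else B'
    let U : Finset (MvPolynomial (Fin (n + 1)) ℚ) :=
      (Finset.range k).biUnion fun i => (A i).image fun b => X 0 ^ i * rename Fin.succ b
    refine ⟨U, ?_, ?_⟩
    · refine Finset.card_biUnion_le.trans ?_
      calc ∑ i ∈ Finset.range k, ((A i).image fun b => X 0 ^ i * rename Fin.succ b).card
          ≤ ∑ i ∈ Finset.range k, (A i).card := Finset.sum_le_sum fun i _ => Finset.card_image_le
        _ = s * B.card + (k - s) * B'.card := by
          rw [Finset.range_eq_Ico, ← Finset.sum_Ico_consecutive _ (Nat.zero_le s) hsk,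
            Finset.sum_congr rfl fun i hi => by
              rw [show A i = B from if_pos (Finset.mem_Ico.1 hi).2],
            Finset.sum_congr (s₁ := Finset.Ico s k) rfl fun i hi => by
              rw [show A i = B' from if_neg (Finset.mem_Ico.1 hi).1.not_gt]]
          simp
        _ ≤ _ := by rw [coverCount]; gcongr
    · suffices H : ∀ m i, i + m = k → ∀ p : MvPolynomial (Fin (n + 1)) ℚ,
          ∃ b ∈ Submodule.span ℚ (U : Set (MvPolynomial (Fin (n + 1)) ℚ)),
            X 0 ^ i * p - b ∈ powEsymmIdeal (n + 1) k s by
        simpa using H k 0 (by omega)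
      intro m
      induction m with
      | zero =>
        rintro i rfl p
        refine ⟨0, Submodule.zero_mem _, ?_⟩
        rw [sub_zero, mul_comm]
        exact Ideal.mul_mem_left _ _ (Ideal.subset_span (Or.inl ⟨0, rfl⟩))
      | succ m ihm =>
        intro i hi p
        obtain ⟨p₀, q, rfl⟩ := exists_eq_rename_succ_add p
        obtain ⟨b, hbA, hb⟩ : ∃ b ∈ Submodule.span ℚ (A i : Set (MvPolynomial (Fin n) ℚ)),
            X 0 ^ i * rename Fin.succ (p₀ - b) ∈
              powEsymmIdeal (n + 1) k s ⊔ Ideal.span {X 0 ^ (i + 1)} := by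
          by_cases his : i < s
          · obtain ⟨b, hb, hpb⟩ := hBs p₀
            exact ⟨b, by rwa [show A i = B from if_pos his],
              X_pow_mul_rename_mem_sup (Or.inl (by omega)) hpb⟩
          · obtain ⟨b, hb, hpb⟩ := hBs' p₀
            exact ⟨b, by rwa [show A i = B' from if_neg his],
              X_pow_mul_rename_mem_sup (Or.inr ⟨rfl, by omega⟩) hpb⟩
        obtain ⟨u, hu, v, hv, huv⟩ := Submodule.mem_sup.1 hb
        obtain ⟨w, rfl⟩ := Ideal.mem_span_singleton'.1 hv
        obtain ⟨c, hc, hqc⟩ := ihm (i + 1) (by omega) (q + w)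
        refine ⟨X 0 ^ i * rename Fin.succ b + c, Submodule.add_mem _ ?_ hc, ?_⟩
        · let φ : MvPolynomial (Fin n) ℚ →ₗ[ℚ] MvPolynomial (Fin (n + 1)) ℚ :=
            LinearMap.mulLeft ℚ (X 0 ^ i) ∘ₗ (rename Fin.succ).toLinearMap
          have h := Submodule.mem_map_of_mem (f := φ) hbA
          rw [Submodule.map_span] at h
          refine Submodule.span_mono ?_ h
          rintro _ ⟨x, hx, rfl⟩
          exact Finset.mem_biUnion.2 ⟨i, Finset.mem_range.2 (by omega),
            Finset.mem_image.2 ⟨x, hx, rfl⟩⟩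
        · convert Ideal.add_mem _ hqc hu using 1
          rw [map_sub] at huv
          linear_combination -huv

/-- Functions `Fin n → Fin k` whose image contains the first `s` elements. -/
abbrev CoveringFun (n k s : ℕ) : Type :=
  {f : Fin n → Fin k // ∀ j : Fin k, (j : ℕ) < s → ∃ i : Fin n, f i = j}

/-- Restriction of a polynomial to the locus of points `(f 1, …, f n)`, with `f` a function
whose image contains the first `s` elements. -/
noncomputable def evalCovering (n k s : ℕ) :
    MvPolynomial (Fin n) ℚ →ₐ[ℚ] (CoveringFun n k s → ℚ) :=
  AlgHom.pi fun f => aeval fun i => ((f.1 i : ℕ) : ℚ)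

lemma evalCovering_apply {n k s : ℕ} (p : MvPolynomial (Fin n) ℚ) (f : CoveringFun n k s) :
    evalCovering n k s p f = eval (fun i => ((f.1 i : ℕ) : ℚ)) p := by
  simp [evalCovering, aeval_eq_eval]

/-- The functions on the point locus which are restrictions of polynomials of degree `< d`. -/
noncomputable def lowDegree (n k s d : ℕ) : Submodule ℚ (CoveringFun n k s → ℚ) :=
  Submodule.span ℚ (evalCovering n k s '' {p | ∃ j < d, p.IsHomogeneous j})

lemma evalCovering_mem_lowDegree {n k s d j : ℕ} {p : MvPolynomial (Fin n) ℚ}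
    (hp : p.IsHomogeneous j) (hj : j < d) : evalCovering n k s p ∈ lowDegree n k s d :=
  Submodule.subset_span ⟨p, ⟨j, hj, hp⟩, rfl⟩

lemma evalCovering_mul_mem_lowDegree {n k s d j : ℕ} {p : MvPolynomial (Fin n) ℚ}
    (hp : p.IsHomogeneous j) {v : CoveringFun n k s → ℚ} (hv : v ∈ lowDegree n k s d) :
    evalCovering n k s p * v ∈ lowDegree n k s (j + d) := by
  induction hv using Submodule.span_induction with
  | zero => simp
  | add u v _ _ hu hv => rw [mul_add]; exact Submodule.add_mem _ hu hv
  | smul a v _ hv => rw [mul_smul_comm]; exact Submodule.smul_mem _ _ hv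
  | mem v hv =>
    obtain ⟨q, ⟨i, hi, hq⟩, rfl⟩ := hv
    rw [← map_mul]
    exact evalCovering_mem_lowDegree (hp.mul hq) (by omega)

lemma evalCovering_X_pow_mem_lowDegree {n k s : ℕ} (i : Fin n) :
    evalCovering n k s (X i ^ k) ∈ lowDegree n k s k := by
  let P : Polynomial ℚ := ∏ j : Fin k, (Polynomial.X - Polynomial.C ((j : ℕ) : ℚ))
  have hP : P.Monic := Polynomial.monic_prod_of_monic _ _ fun j _ => Polynomial.monic_X_sub_C _
  have hdeg : P.natDegree = k := by
    rw [Polynomial.natDegree_prod_of_monic _ _ fun j _ => Polynomial.monic_X_sub_C _]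
    simp [-map_natCast]
  have h : evalCovering n k s (X i ^ k) =
      -∑ m ∈ Finset.range k, P.coeff m • evalCovering n k s (X i ^ m) := by
    funext f
    have h0 : P.eval ((f.1 i : ℕ) : ℚ) = 0 := by
      simp only [P, Polynomial.eval_prod, Polynomial.eval_sub, Polynomial.eval_X,
        Polynomial.eval_C]
      exact Finset.prod_eq_zero (Finset.mem_univ (f.1 i)) (sub_self _)
    rw [hP.as_sum, hdeg] at h0
    simp only [Polynomial.eval_add, Polynomial.eval_pow, Polynomial.eval_X,
      Polynomial.eval_finsetSum, Polynomial.eval_mul, Polynomial.eval_C] at h0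
    simp only [evalCovering_apply, Pi.neg_apply, Finset.sum_apply, Pi.smul_apply, smul_eq_mul,
      eval_pow, eval_X]
    linarith
  rw [h]
  refine Submodule.neg_mem _ (Submodule.sum_mem _ fun m hm => Submodule.smul_mem _ _ ?_)
  exact evalCovering_mem_lowDegree (isHomogeneous_X_pow i m) (Finset.mem_range.1 hm)

lemma coeff_prod_one_add_C_mul_X {n : ℕ} (y : Fin n → ℚ) (d : ℕ) :
    (∏ i, (1 + Polynomial.C (y i) * Polynomial.X)).coeff d = eval y (esymm (Fin n) ℚ d) := by
  rw [Finset.prod_one_add, Polynomial.finsetSum_coeff, esymm, map_sum]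
  simp_rw [Finset.prod_mul_distrib, Finset.prod_const, ← map_prod, Polynomial.coeff_C_mul_X_pow,
    map_prod, eval_X]
  rw [← Finset.sum_filter]
  congr 1
  ext t
  simp [Finset.mem_powersetCard, eq_comm]

lemma isHomogeneous_esymm_fin (n d : ℕ) : (esymm (Fin n) ℚ d).IsHomogeneous d := by
  refine IsHomogeneous.sum _ _ _ fun t ht => ?_
  rw [← (Finset.mem_powersetCard.1 ht).2]
  simpa using IsHomogeneous.prod t (fun i => (X i : MvPolynomial (Fin n) ℚ)) (fun _ => 1)
    fun i _ => isHomogeneous_X ℚ i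

lemma evalCovering_esymm_mem_lowDegree {n k s d : ℕ} (hsk : s ≤ k) (hd : n + 1 ≤ d + s) :
    evalCovering n k s (esymm (Fin n) ℚ d) ∈ lowDegree n k s d := by
  let A : Polynomial ℚ := ∏ j : Fin s, (1 + Polynomial.C ((j : ℕ) : ℚ) * Polynomial.X)
  let H : PowerSeries ℚ := (A : PowerSeries ℚ)⁻¹
  have hA0 : PowerSeries.constantCoeff (A : PowerSeries ℚ) = 1 := by
    rw [Polynomial.constantCoeff_coe]
    simp [A, Polynomial.coeff_zero_eq_eval_zero, Polynomial.eval_prod]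
  have hH0 : PowerSeries.coeff 0 H = 1 := by
    simp [H, hA0]
  have h : evalCovering n k s (esymm (Fin n) ℚ d) =
      -∑ m ∈ Finset.range d,
        PowerSeries.coeff (d - m) H • evalCovering n k s (esymm (Fin n) ℚ m) := by
    funext f
    let E : Polynomial ℚ := ∏ i, (1 + Polynomial.C ((f.1 i : ℕ) : ℚ) * Polynomial.X)
    choose g hg using fun j : Fin s => f.2 (Fin.castLE hsk j) j.2
    have hginj : Function.Injective g := fun a b hab => by
      have := (hg a).symm.trans ((congrArg f.1 hab).trans (hg b))
      exact Fin.castLE_injective hsk this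
    let Q : Polynomial ℚ := ∏ i ∈ (Finset.univ.image g)ᶜ,
      (1 + Polynomial.C ((f.1 i : ℕ) : ℚ) * Polynomial.X)
    have hE : E = A * Q := by
      rw [show E = _ from (Finset.prod_mul_prod_compl (Finset.univ.image g) _).symm,
        Finset.prod_image hginj.injOn]
      simp [A, Q, hg]
    have hQ : Q.natDegree < d := by
      have hle : Q.natDegree ≤ ((Finset.univ.image g)ᶜ).card := by
        refine (Polynomial.natDegree_prod_le _ _).trans ?_
        refine (Finset.sum_le_card_nsmul _ _ 1 fun i _ => ?_).trans (by simp)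
        compute_degree
      rw [Finset.card_compl, Finset.card_image_of_injective _ hginj] at hle
      simp only [Fintype.card_fin, Finset.card_univ] at hle
      have := Fintype.card_le_of_injective g hginj
      simp only [Fintype.card_fin] at this
      omega
    have hEH : H * (E : PowerSeries ℚ) = (Q : PowerSeries ℚ) := by
      rw [hE, Polynomial.coe_mul, ← mul_assoc, PowerSeries.inv_mul_cancel _ (by simp [hA0]),
        one_mul]
    have h0 := congrArg (PowerSeries.coeff d) hEH
    rw [Polynomial.coeff_coe, Polynomial.coeff_eq_zero_of_natDegree_lt hQ, mul_comm,
      PowerSeries.coeff_mul,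
      Finset.Nat.sum_antidiagonal_eq_sum_range_succ_mk, Finset.sum_range_succ] at h0
    simp only [Polynomial.coeff_coe, Nat.sub_self, hH0, mul_one, E,
      coeff_prod_one_add_C_mul_X] at h0
    simp only [evalCovering_apply, Pi.neg_apply, Finset.sum_apply, Pi.smul_apply, smul_eq_mul]
    simp_rw [mul_comm (PowerSeries.coeff _ H)]
    linarith
  rw [h]
  refine Submodule.neg_mem _ (Submodule.sum_mem _ fun m hm => Submodule.smul_mem _ _ ?_)
  exact evalCovering_mem_lowDegree (isHomogeneous_esymm_fin n m) (Finset.mem_range.1 hm)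

section Graded

attribute [local instance] MvPolynomial.gradedAlgebra

lemma homogeneousComponent_mul_of_isHomogeneous {n d e : ℕ} {p : MvPolynomial (Fin n) ℚ}
    (hp : p.IsHomogeneous e) (q : MvPolynomial (Fin n) ℚ) :
    homogeneousComponent d (p * q) = if e ≤ d then p * homogeneousComponent (d - e) q else 0 := by
  have hdec : ∀ (r : MvPolynomial (Fin n) ℚ) (j : ℕ),
      (DirectSum.decompose (homogeneousSubmodule (Fin n) ℚ) r j : MvPolynomial (Fin n) ℚ) =
        homogeneousComponent j r := fun r j => decomposition.decompose'_apply r j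
  rw [← hdec, ← hdec]
  exact DirectSum.coe_decompose_mul_of_left_mem (homogeneousSubmodule (Fin n) ℚ) d hp

lemma exists_isHomogeneous_evalCovering_mem {n k s : ℕ} (hsk : s ≤ k) (hsn : s ≤ n)
    {g : MvPolynomial (Fin n) ℚ} (hg : (∃ i : Fin n, g = X i ^ k) ∨
      ∃ d : ℕ, n - s + 1 ≤ d ∧ d ≤ n ∧ g = esymm (Fin n) ℚ d) :
    ∃ e, g.IsHomogeneous e ∧ evalCovering n k s g ∈ lowDegree n k s e := by
  rcases hg with ⟨i, rfl⟩ | ⟨d, hd, -, rfl⟩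
  · exact ⟨k, isHomogeneous_X_pow i k, evalCovering_X_pow_mem_lowDegree i⟩
  · exact ⟨d, isHomogeneous_esymm_fin n d, evalCovering_esymm_mem_lowDegree hsk (by omega)⟩

lemma Inks_isHomogeneous (n k s : ℕ) :
    (Inks n k s).IsHomogeneous (homogeneousSubmodule (Fin n) ℚ) := by
  refine Ideal.homogeneous_span _ _ ?_
  rintro g (⟨i, rfl⟩ | ⟨d, -, -, rfl⟩)
  · exact ⟨k, isHomogeneous_X_pow i k⟩
  · exact ⟨d, isHomogeneous_esymm_fin n d⟩

lemma evalCovering_homogeneousComponent_mem {n k s : ℕ} (hsk : s ≤ k) (hsn : s ≤ n)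
    {q : MvPolynomial (Fin n) ℚ} (hq : q ∈ Inks n k s) (d : ℕ) :
    evalCovering n k s (homogeneousComponent d q) ∈ lowDegree n k s d := by
  induction hq using Submodule.span_induction generalizing d with
  | zero => simp
  | add p q _ _ hp hq => rw [map_add, map_add]; exact Submodule.add_mem _ (hp d) (hq d)
  | smul a q _ hq =>
    rw [smul_eq_mul, ← sum_homogeneousComponent a, Finset.sum_mul, map_sum, map_sum]
    refine Submodule.sum_mem _ fun e _ => ?_
    rw [homogeneousComponent_mul_of_isHomogeneous (homogeneousComponent_isHomogeneous e a)]
    split_ifs with h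
    · rw [map_mul]
      have := evalCovering_mul_mem_lowDegree (homogeneousComponent_isHomogeneous e a) (hq (d - e))
      rwa [Nat.add_sub_cancel' h] at this
    · simp
  | mem g hg =>
    obtain ⟨e, he, heg⟩ := exists_isHomogeneous_evalCovering_mem hsk hsn hg
    rw [homogeneousComponent_of_mem he]
    split_ifs with h
    · rwa [h]
    · simp

lemma rename_mem_Inks {n k s : ℕ} (σ : Equiv.Perm (Fin n)) {p : MvPolynomial (Fin n) ℚ}
    (hp : p ∈ Inks n k s) : rename σ p ∈ Inks n k s := by
  suffices h : Inks n k s ≤ (Inks n k s).comap (rename σ) from h hp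
  refine Ideal.span_le.2 ?_
  rintro g (⟨i, rfl⟩ | ⟨d, hd, hdn, rfl⟩)
  · exact Ideal.subset_span (Or.inl ⟨σ i, by simp⟩)
  · exact Ideal.subset_span (Or.inr ⟨d, hd, hdn, by simp [rename_esymm]⟩)

lemma evalCovering_surjective (n k s : ℕ) : Function.Surjective (evalCovering n k s) := by
  classical
  let P (f : CoveringFun n k s) : MvPolynomial (Fin n) ℚ :=
    ∏ i, ∏ j ∈ Finset.univ.erase (f.1 i), (X i - C ((j : ℕ) : ℚ))
  have hP : ∀ f g : CoveringFun n k s, evalCovering n k s (P f) g ≠ 0 ↔ g = f := by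
    intro f g
    simp only [P, evalCovering_apply, map_prod, map_sub, eval_X, eval_C, Finset.prod_ne_zero_iff,
      sub_ne_zero, Finset.mem_univ, forall_true_left, Finset.mem_erase, and_true, ne_eq,
      Nat.cast_inj, Fin.val_inj]
    refine ⟨fun h => Subtype.ext (funext fun i => ?_), ?_⟩
    · by_contra hi
      exact h i _ hi rfl
    · rintro rfl i j hj rfl
      exact hj rfl
  intro v
  refine ⟨∑ f, C (v f / evalCovering n k s (P f) f) * P f, ?_⟩
  funext g
  rw [map_sum, Finset.sum_apply, Finset.sum_eq_single g]
  · rw [map_mul, Pi.mul_apply, evalCovering_apply (C _), eval_C,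
      div_mul_cancel₀ _ ((hP g g).2 rfl)]
  · intro f _ hf
    rw [map_mul, Pi.mul_apply, not_not.1 (mt (hP f g).1 hf.symm), mul_zero]
  · simp

/-- A homogeneous ideal of a polynomial ring has a degree-preserving linear complement. -/
lemma exists_graded_projection {n : ℕ} {I : Ideal (MvPolynomial (Fin n) ℚ)}
    (hI : I.IsHomogeneous (homogeneousSubmodule (Fin n) ℚ)) :
    ∃ π : MvPolynomial (Fin n) ℚ →ₗ[ℚ] MvPolynomial (Fin n) ℚ,
      (∀ p ∈ I, π p = 0) ∧ (∀ p, p - π p ∈ I) ∧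
        ∀ d p, p.IsHomogeneous d → (π p).IsHomogeneous d := by
  have h : ∀ d, ∃ r : MvPolynomial (Fin n) ℚ →ₗ[ℚ] MvPolynomial (Fin n) ℚ,
      (∀ p, r p ∈ I ∧ (r p).IsHomogeneous d) ∧ ∀ p ∈ I, p.IsHomogeneous d → r p = p := by
    intro d
    let W := I.restrictScalars ℚ ⊓ homogeneousSubmodule (Fin n) ℚ d
    obtain ⟨g, hg⟩ := W.subtype.exists_leftInverse_of_injective W.ker_subtype
    refine ⟨W.subtype ∘ₗ g, fun p => (g p).2, fun p hp hpd => ?_⟩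
    have := LinearMap.congr_fun hg ⟨p, hp, hpd⟩
    exact congrArg Subtype.val this
  choose r hr hrI using h
  let ρ : MvPolynomial (Fin n) ℚ →ₗ[ℚ] MvPolynomial (Fin n) ℚ :=
    (basisMonomials (Fin n) ℚ).constr ℚ fun m => r m.degree (monomial m 1)
  have hρ : ∀ d p, p.IsHomogeneous d → ρ p = r d p := by
    intro d p hp
    conv_lhs => rw [p.as_sum]
    conv_rhs => rw [p.as_sum]
    rw [map_sum, map_sum]
    refine Finset.sum_congr rfl fun m hm => ?_
    have hmd : m.degree = d := by
      rw [Finsupp.degree_eq_weight_one]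
      exact hp (mem_support_iff.1 hm)
    have h1 : ρ (monomial m 1) = r m.degree (monomial m 1) := by
      have := (basisMonomials (Fin n) ℚ).constr_basis ℚ
        (fun m => r m.degree (monomial m 1)) m
      rwa [coe_basisMonomials] at this
    rw [← mul_one (coeff m p), ← smul_eq_mul, ← smul_monomial, map_smul, map_smul, h1, hmd]
  have hsum : ∀ p, ρ p =
      ∑ i ∈ Finset.range (p.totalDegree + 1), r i (homogeneousComponent i p) := by
    intro p
    conv_lhs => rw [← sum_homogeneousComponent p, map_sum]
    exact Finset.sum_congr rfl fun i _ => hρ i _ (homogeneousComponent_isHomogeneous i p)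
  refine ⟨LinearMap.id - ρ, fun p hp => ?_, fun p => ?_, fun d p hp => ?_⟩
  · rw [LinearMap.sub_apply, LinearMap.id_apply, hsum, sub_eq_zero]
    conv_lhs => rw [← sum_homogeneousComponent p]
    exact Finset.sum_congr rfl fun i _ => (hrI i _ (homogeneousComponent_mem_of_mem hI hp i)
      (homogeneousComponent_isHomogeneous i p)).symm
  · rw [LinearMap.sub_apply, LinearMap.id_apply, sub_sub_cancel, hsum]
    exact Ideal.sum_mem _ fun i _ => (hr i _).1
  · rw [LinearMap.sub_apply, LinearMap.id_apply, hρ d p hp]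
    exact hp.sub (hr d p).2

/-- A homogeneous ideal which is stable under permutations of the variables has a
degree-preserving linear complement with the same property. -/
lemma exists_equivariant_graded_projection {n : ℕ} {I : Ideal (MvPolynomial (Fin n) ℚ)}
    (hI : I.IsHomogeneous (homogeneousSubmodule (Fin n) ℚ))
    (hσ : ∀ (σ : Equiv.Perm (Fin n)), ∀ p ∈ I, rename σ p ∈ I) :
    ∃ π : MvPolynomial (Fin n) ℚ →ₗ[ℚ] MvPolynomial (Fin n) ℚ,
      (∀ p ∈ I, π p = 0) ∧ (∀ p, p - π p ∈ I) ∧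
        (∀ d p, p.IsHomogeneous d → (π p).IsHomogeneous d) ∧
        ∀ (σ : Equiv.Perm (Fin n)) p, π (rename σ p) = rename σ (π p) := by
  obtain ⟨π, hπI, hπ, hπd⟩ := exists_graded_projection hI
  let c : ℚ := (Fintype.card (Equiv.Perm (Fin n)) : ℚ)⁻¹
  let π' : MvPolynomial (Fin n) ℚ →ₗ[ℚ] MvPolynomial (Fin n) ℚ :=
    c • ∑ τ : Equiv.Perm (Fin n), (rename ⇑τ⁻¹).toLinearMap ∘ₗ π ∘ₗ (rename ⇑τ).toLinearMap
  have happ : ∀ p, π' p = c • ∑ τ : Equiv.Perm (Fin n), rename ⇑τ⁻¹ (π (rename ⇑τ p)) := by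
    intro p; simp [π']
  refine ⟨π', fun p hp => ?_, fun p => ?_, fun d p hp => ?_, fun σ p => ?_⟩
  · rw [happ, Finset.sum_eq_zero fun τ _ => by rw [hπI _ (hσ τ p hp), map_zero], smul_zero]
  · have hp : p = c • ∑ τ : Equiv.Perm (Fin n), p := by
      rw [Finset.sum_const, ← Nat.cast_smul_eq_nsmul ℚ, smul_smul, Finset.card_univ,
        inv_mul_cancel₀ (by positivity), one_smul]
    have h : p - π' p = c • ∑ τ : Equiv.Perm (Fin n),
        rename ⇑τ⁻¹ (rename ⇑τ p - π (rename ⇑τ p)) := by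
      conv_lhs => rw [happ]; enter [1]; rw [hp]
      rw [← smul_sub, ← Finset.sum_sub_distrib]
      refine congrArg _ (Finset.sum_congr rfl fun τ _ => ?_)
      rw [map_sub, rename_rename, ← Equiv.Perm.coe_mul, inv_mul_cancel, Equiv.Perm.coe_one,
        rename_id_apply]
    rw [h]
    exact (I.restrictScalars ℚ).smul_mem _ (Ideal.sum_mem _ fun τ _ => hσ _ _ (hπ _))
  · rw [happ]
    refine (homogeneousSubmodule (Fin n) ℚ d).smul_mem _ (Submodule.sum_mem _ fun τ _ => ?_)
    exact (hπd d _ hp.rename_isHomogeneous).rename_isHomogeneous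
  · rw [happ, happ, map_smul, map_sum]
    congr 1
    refine Fintype.sum_equiv (Equiv.mulRight σ) _ _ fun τ => ?_
    simp [rename_rename, ← Equiv.Perm.coe_mul]

lemma evalCovering_comp_surjective {n k s : ℕ} (hsk : s ≤ k) (hsn : s ≤ n)
    {π : MvPolynomial (Fin n) ℚ →ₗ[ℚ] MvPolynomial (Fin n) ℚ}
    (hπ : ∀ p, p - π p ∈ Inks n k s)
    (hπd : ∀ d p, p.IsHomogeneous d → (π p).IsHomogeneous d) :
    Function.Surjective ((evalCovering n k s).toLinearMap ∘ₗ π) := by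
  have key : ∀ d, lowDegree n k s d ≤ LinearMap.range ((evalCovering n k s).toLinearMap ∘ₗ π) := by
    intro d
    induction d using Nat.strong_induction_on with
    | _ d ih =>
      refine Submodule.span_le.2 ?_
      rintro _ ⟨p, ⟨j, hj, hp⟩, rfl⟩
      have h := evalCovering_homogeneousComponent_mem hsk hsn (hπ p) j
      rw [homogeneousComponent_eq_self (hp.sub (hπd j p hp)), map_sub] at h
      simpa using Submodule.add_mem _ (ih j hj h) ⟨p, rfl⟩
  intro v
  obtain ⟨p, rfl⟩ := evalCovering_surjective n k s v
  rw [← LinearMap.mem_range, ← sum_homogeneousComponent p, map_sum]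
  exact Submodule.sum_mem _ fun i _ => key (i + 1)
    (evalCovering_mem_lowDegree (homogeneousComponent_isHomogeneous i p) i.lt_succ_self)

lemma card_coveringFun {n k s : ℕ} (hsk : s ≤ k) :
    Fintype.card (CoveringFun n k s) = coverCount k n s := by
  have h := card_functions_covering k n (Finset.univ.filter fun j : Fin k => (j : ℕ) < s)
  rw [Fin.card_filter_val_lt, min_eq_right hsk] at h
  rw [← h]
  exact Fintype.card_congr (Equiv.subtypeEquivRight fun f => by simp)

end Graded

/-- `R_{n,k,s} ≅ ℚ[OP_{n,k,s}]` as ungraded `S_n`-modules: there is a `ℚ`-linear bijection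
between `R_{n,k,s} = ℚ[x_1, …, x_n]/I_{n,k,s}` and the free `ℚ`-vector space on the
functions `f : {1,…,n} → {1,…,k}` whose image contains `{1,…,s}` (realized as the function
space on this finite basis), intertwining the action of `σ ∈ S_n` by `x_i ↦ x_{σ(i)}`
(i.e. `rename σ`) with the action `f ↦ f ∘ σ⁻¹` on basis elements; equivalently, for a
vector `v` in the function-space model, `(σ • v) f = v (f ∘ σ)`. -/
theorem stmt17 (n k s : ℕ) (hs : 1 ≤ s) (hsk : s ≤ k) (hkn : k ≤ n) :
    ∃ e : (MvPolynomial (Fin n) ℚ ⧸ Inks n k s) ≃ₗ[ℚ]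
        ({f : Fin n → Fin k // ∀ j : Fin k, (j : ℕ) < s → ∃ i : Fin n, f i = j} → ℚ),
      ∀ (σ : Equiv.Perm (Fin n)) (p : MvPolynomial (Fin n) ℚ)
        (f : {f : Fin n → Fin k // ∀ j : Fin k, (j : ℕ) < s → ∃ i : Fin n, f i = j}),
        e (Ideal.Quotient.mk (Inks n k s) (rename σ p)) f
          = e (Ideal.Quotient.mk (Inks n k s) p)
              ⟨f.1 ∘ σ, fun j hj => by
                obtain ⟨i, hi⟩ := f.2 j hj
                exact ⟨σ⁻¹ i, by simp [hi]⟩⟩ := by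
  obtain ⟨π, hπI, hπ, hπd, hπσ⟩ := exists_equivariant_graded_projection
    (Inks_isHomogeneous n k s) fun σ p hp => rename_mem_Inks σ hp
  let φ := (evalCovering n k s).toLinearMap ∘ₗ π
  have hφ : Function.Surjective φ := evalCovering_comp_surjective hsk (hsk.trans hkn) hπ hπd
  let ψ : (MvPolynomial (Fin n) ℚ ⧸ Inks n k s) →ₗ[ℚ] (CoveringFun n k s → ℚ) :=
    ((Inks n k s).restrictScalars ℚ).liftQ φ (fun p hp => by
      simp [φ, hπI p hp]) ∘ₗ (Submodule.Quotient.restrictScalarsEquiv ℚ (Inks n k s)).symm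
  have hψ : ∀ p, ψ (Ideal.Quotient.mk _ p) = φ p := fun p => rfl
  have hψs : Function.Surjective ψ := fun v => (hφ v).imp' (Ideal.Quotient.mk _) fun p hp => hp
  obtain ⟨B, hB, hBs⟩ := exists_spanning_finset k n s hsk
  rw [powEsymmIdeal_eq_Inks (hsk.trans hkn)] at hBs
  let mk : MvPolynomial (Fin n) ℚ →ₗ[ℚ] (MvPolynomial (Fin n) ℚ ⧸ Inks n k s) :=
    (Ideal.Quotient.mkₐ ℚ (Inks n k s)).toLinearMap
  let b : B → MvPolynomial (Fin n) ℚ ⧸ Inks n k s := fun x => mk x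
  have hspan : Submodule.span ℚ (Set.range b) = ⊤ := by
    rw [eq_top_iff]
    rintro x -
    obtain ⟨p, rfl⟩ := Ideal.Quotient.mk_surjective x
    obtain ⟨c, hc, hpc⟩ := hBs p
    rw [Ideal.Quotient.eq.2 hpc]
    have h := Submodule.mem_map_of_mem (f := mk) hc
    rw [Submodule.map_span] at h
    refine Submodule.span_mono ?_ h
    rintro _ ⟨y, hy, rfl⟩
    exact ⟨⟨y, hy⟩, rfl⟩
  have : FiniteDimensional ℚ (MvPolynomial (Fin n) ℚ ⧸ Inks n k s) :=
    Module.Finite.of_surjective (Fintype.linearCombination ℚ b)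
      (LinearMap.range_eq_top.1 (by rw [Fintype.range_linearCombination, hspan]))
  have hle : Module.finrank ℚ (MvPolynomial (Fin n) ℚ ⧸ Inks n k s) ≤
      Module.finrank ℚ (CoveringFun n k s → ℚ) := by
    rw [Module.finrank_fintype_fun_eq_card, card_coveringFun hsk]
    refine le_trans ?_ hB
    rw [← finrank_top, ← hspan]
    exact (finrank_range_le_card b).trans (by simp)
  have hfin := hle.antisymm (LinearMap.finrank_le_finrank_of_surjective hψs)
  refine ⟨LinearEquiv.ofBijective ψ
    ⟨(LinearMap.injective_iff_surjective_of_finrank_eq_finrank hfin).2 hψs, hψs⟩, ?_⟩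
  intro σ p f
  change φ (rename σ p) f = φ p _
  simp only [φ, LinearMap.comp_apply, AlgHom.toLinearMap_apply, hπσ, evalCovering_apply,
    eval_rename]
  rfl
end
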